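/- arXiv:2202.09309 — 2 statements merged into one kernel-verified Lean document; each statement's English description precedes it below -/
import Mathlib

section
/- Fix a correlation ρ with −1 < ρ < 1 and an integer m ≥ 2. Then for every integer k ≥ m²−1 one has S_{ρ,m}(k) = S_{ρ,m}(m²−1); that is, the set of m×m probability distribution matrices noninteractively simulatable from ρ-correlated Gaussian sources of dimension k is the same for all k ≥ m²−1. -/
open MeasureTheory

noncomputable def gauss (d : ℕ) : Measure (EuclideanSpace ℝ (Fin d)) :=
  volume.withDensity (fun x => ENNReal.ofReal ((2 * Real.pi) ^ (-(d : ℝ) / 2) * Real.exp (-‖x‖ ^ 2 / 2)))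

noncomputable def OU (d : ℕ) (ρ : ℝ) (f : EuclideanSpace ℝ (Fin d) → ℝ)
    (x : EuclideanSpace ℝ (Fin d)) : ℝ :=
  ∫ y, f (ρ • x + Real.sqrt (1 - ρ ^ 2) • y) ∂(gauss d)

noncomputable def Cmat (d m : ℕ) (ρ : ℝ)
    (f g : EuclideanSpace ℝ (Fin d) → (Fin m → ℝ)) : Matrix (Fin m) (Fin m) ℝ :=
  Matrix.of fun i j => ∫ x, f x i * OU d ρ (fun y => g y j) x ∂(gauss d)

def SimplexMap (d m : ℕ) (f : EuclideanSpace ℝ (Fin d) → (Fin m → ℝ)) : Prop :=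
  Measurable f ∧ ∀ x, f x ∈ stdSimplex ℝ (Fin m)

noncomputable def Sset (ρ : ℝ) (m d : ℕ) : Set (Matrix (Fin m) (Fin m) ℝ) :=
  { M | ∃ f g, SimplexMap d m f ∧ SimplexMap d m g ∧ M = Cmat d m ρ f g }

open Filter Topology ProbabilityTheory
open scoped ENNReal

/-! ### The Gaussian measure -/

section Gaussian

variable {d m : ℕ}

theorem measurable_gaussDensity (d : ℕ) : Measurable fun x : EuclideanSpace ℝ (Fin d) =>
    ENNReal.ofReal ((2 * Real.pi) ^ (-(d : ℝ) / 2) * Real.exp (-‖x‖ ^ 2 / 2)) := by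
  fun_prop

theorem gaussDensity_pos (x : EuclideanSpace ℝ (Fin d)) :
    0 < (2 * Real.pi) ^ (-(d : ℝ) / 2) * Real.exp (-‖x‖ ^ 2 / 2) := by
  positivity

theorem integral_gauss {F : Type*} [NormedAddCommGroup F] [NormedSpace ℝ F]
    (φ : EuclideanSpace ℝ (Fin d) → F) :
    ∫ x, φ x ∂(gauss d) =
      ∫ x, ((2 * Real.pi) ^ (-(d : ℝ) / 2) * Real.exp (-‖x‖ ^ 2 / 2)) • φ x := by
  rw [gauss, integral_withDensity_eq_integral_toReal_smul (measurable_gaussDensity d)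
    (by simp)]
  simp_rw [ENNReal.toReal_ofReal (gaussDensity_pos _).le]

theorem two_pi_rpow_mul (d : ℕ) :
    (2 * Real.pi) ^ (-(d : ℝ) / 2) * (2 * Real.pi) ^ ((d : ℝ) / 2) = 1 := by
  rw [← Real.rpow_add (by positivity)]
  simp [neg_div]

instance isProbabilityMeasure_gauss : IsProbabilityMeasure (gauss d) := by
  constructor
  have hInt : Integrable fun x : EuclideanSpace ℝ (Fin d) =>
      (2 * Real.pi) ^ (-(d : ℝ) / 2) * Real.exp (-‖x‖ ^ 2 / 2) := by
    refine Integrable.const_mul ?_ _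
    have := (GaussianFourier.integrable_cexp_neg_mul_sq_norm_add (b := (1 / 2 : ℂ))
      (by norm_num) 0 (0 : EuclideanSpace ℝ (Fin d))).norm
    refine this.congr (ae_of_all _ fun x => ?_)
    simp only [Complex.norm_exp]
    congr 1
    simp [← Complex.ofReal_pow]
    ring
  rw [gauss, withDensity_apply _ MeasurableSet.univ, Measure.restrict_univ,
    ← ofReal_integral_eq_lintegral_ofReal hInt (ae_of_all _ fun x => (gaussDensity_pos x).le),
    integral_const_mul]
  have := GaussianFourier.integral_rexp_neg_mul_sq_norm (V := EuclideanSpace ℝ (Fin d))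
    (b := 1 / 2) (by norm_num)
  have h2 : ∀ x : EuclideanSpace ℝ (Fin d), -‖x‖ ^ 2 / 2 = -(1 / 2) * ‖x‖ ^ 2 := fun x => by ring
  simp_rw [h2]
  rw [this]
  have h3 : Real.pi / (1 / 2) = 2 * Real.pi := by ring
  rw [h3, finrank_euclideanSpace_fin, two_pi_rpow_mul]
  simp

theorem gauss_eq_stdGaussian (d : ℕ) : gauss d = stdGaussian (EuclideanSpace ℝ (Fin d)) := by
  refine Measure.ext_of_charFun ?_
  ext t
  rw [charFun_stdGaussian, charFun_apply, integral_gauss]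
  have := GaussianFourier.integral_cexp_neg_mul_sq_norm_add (V := EuclideanSpace ℝ (Fin d))
    (b := 1 / 2) (by norm_num) Complex.I t
  have h : ∀ x : EuclideanSpace ℝ (Fin d),
      ((2 * Real.pi) ^ (-(d : ℝ) / 2) * Real.exp (-‖x‖ ^ 2 / 2)) •
        Complex.exp (inner ℝ x t * Complex.I) = ((2 * Real.pi) ^ (-(d : ℝ) / 2) : ℝ) *
        Complex.exp (-(1 / 2) * ‖x‖ ^ 2 + Complex.I * inner ℝ t x) := fun x => by
    rw [Complex.real_smul, Complex.ofReal_mul, Complex.ofReal_exp, mul_assoc, ← Complex.exp_add,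
      real_inner_comm]
    congr 2
    push_cast
    ring
  simp_rw [h]
  rw [integral_const_mul, this, finrank_euclideanSpace_fin, ← mul_assoc]
  have h3 : (Real.pi / (1 / 2) : ℂ) ^ ((d : ℂ) / 2) = ((2 * Real.pi) ^ ((d : ℝ) / 2) : ℝ) := by
    rw [Complex.ofReal_cpow (by positivity)]
    push_cast
    congr 1
    ring
  rw [h3, ← Complex.ofReal_mul, two_pi_rpow_mul]
  simp only [Complex.I_sq]
  simp
  ring_nf

theorem integral_gauss_add {F : Type*} [NormedAddCommGroup F] [NormedSpace ℝ F]
    (φ : EuclideanSpace ℝ (Fin d) → F) (w : EuclideanSpace ℝ (Fin d)) :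
    ∫ x, φ (x + w) ∂(gauss d) = ∫ x, Real.exp (inner ℝ w x - ‖w‖ ^ 2 / 2) • φ x ∂(gauss d) := by
  rw [integral_gauss, integral_gauss, ← integral_sub_right_eq_self _ w]
  congr 1
  ext x
  rw [sub_add_cancel, smul_smul, mul_assoc, ← Real.exp_add, @norm_sub_sq_real, real_inner_comm]
  congr 3
  ring

theorem gauss_absolutelyContinuous (d : ℕ) : gauss d ≪ volume :=
  withDensity_absolutelyContinuous _ _

theorem volume_absolutelyContinuous_gauss (d : ℕ) : volume ≪ gauss d :=
  withDensity_absolutelyContinuous' (measurable_gaussDensity d).aemeasurable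
    (ae_of_all _ fun x => by simpa using gaussDensity_pos x)

theorem ae_gauss_add {p : EuclideanSpace ℝ (Fin d) → Prop} (h : ∀ᵐ x ∂(gauss d), p x)
    (w : EuclideanSpace ℝ (Fin d)) : ∀ᵐ x ∂(gauss d), p (x + w) :=
  (gauss_absolutelyContinuous d).ae_le
    ((quasiMeasurePreserving_add_right volume w).ae
      ((volume_absolutelyContinuous_gauss d).ae_le h))

theorem map_gauss_affine_absolutelyContinuous {c : ℝ} (hc : c ≠ 0)
    (w : EuclideanSpace ℝ (Fin d)) :
    (gauss d).map (fun y => w + c • y) ≪ gauss d := by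
  have h1 : Measure.QuasiMeasurePreserving (fun y : EuclideanSpace ℝ (Fin d) => w + c • y)
      volume volume := by
    have h2 : Measure.QuasiMeasurePreserving (fun y : EuclideanSpace ℝ (Fin d) => c • y)
        volume volume := by
      refine ⟨by fun_prop, ?_⟩
      rw [Measure.map_addHaar_smul _ hc]
      exact Measure.smul_absolutelyContinuous
    exact (quasiMeasurePreserving_add_left volume w).comp h2
  exact (((gauss_absolutelyContinuous d).map h1.measurable).trans h1.absolutelyContinuous).trans
    (volume_absolutelyContinuous_gauss d)

/-- The law of a pair of `ρ`-correlated Gaussian vectors is symmetric. -/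
theorem integral_gauss_prod_swap {ρ : ℝ} (h1 : -1 ≤ ρ) (h2 : ρ ≤ 1)
    {φ : EuclideanSpace ℝ (Fin d) × EuclideanSpace ℝ (Fin d) → ℝ} (hφ : Measurable φ) :
    ∫ p, φ (p.1, ρ • p.1 + √(1 - ρ ^ 2) • p.2) ∂((gauss d).prod (gauss d)) =
      ∫ p, φ (ρ • p.1 + √(1 - ρ ^ 2) • p.2, p.1) ∂((gauss d).prod (gauss d)) := by
  have hrot := IsGaussian.map_rotation_eq_self_of_forall_strongDual_eq_zero
    (μ := stdGaussian (EuclideanSpace ℝ (Fin d))) integral_strongDual_stdGaussian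
    (-Real.arccos ρ)
  rw [← gauss_eq_stdGaussian] at hrot
  have hneg : (gauss d).map (fun x => -x) = gauss d := by
    rw [gauss_eq_stdGaussian]
    exact stdGaussian_map (LinearIsometryEquiv.neg ℝ)
  have hneg2 : ((gauss d).prod (gauss d)).map (Prod.map id fun x => -x) =
      (gauss d).prod (gauss d) := by
    rw [← Measure.map_prod_map _ _ measurable_id measurable_neg, hneg, Measure.map_id]
  have hm : Measurable fun p : EuclideanSpace ℝ (Fin d) × EuclideanSpace ℝ (Fin d) =>
      φ (p.1, ρ • p.1 + √(1 - ρ ^ 2) • p.2) := hφ.comp (by fun_prop)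
  have hm2 : Measurable fun p : EuclideanSpace ℝ (Fin d) × EuclideanSpace ℝ (Fin d) =>
      φ (ρ • p.1 + √(1 - ρ ^ 2) • p.2, p.1) := hφ.comp (by fun_prop)
  conv_lhs => rw [← hrot]
  conv_rhs => rw [← hneg2]
  rw [integral_map (by fun_prop) hm.aestronglyMeasurable,
    integral_map (by fun_prop) hm2.aestronglyMeasurable]
  congr 1
  ext p
  have hs : √(1 - ρ ^ 2) ^ 2 = 1 - ρ ^ 2 := Real.sq_sqrt (by nlinarith)
  have e1 : ρ • (ρ • p.1 - √(1 - ρ ^ 2) • p.2) + √(1 - ρ ^ 2) • (√(1 - ρ ^ 2) • p.1 + ρ • p.2)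
      = p.1 := by
    calc _ = (ρ ^ 2 + √(1 - ρ ^ 2) ^ 2) • p.1 := by module
      _ = p.1 := by rw [hs]; simp
  simp only [ContinuousLinearMap.rotation_apply, Real.cos_neg, Real.sin_neg, Real.cos_arccos h1 h2,
    Real.sin_arccos, neg_neg, neg_smul, Prod.map, id, smul_neg, ← sub_eq_add_neg]
  rw [e1]

end Gaussian

/-! ### The Ornstein–Uhlenbeck operator -/

section OU

variable {d m : ℕ} {ρ : ℝ}

theorem integrable_of_abs_le {α : Type*} [MeasurableSpace α] {μ : Measure α} [IsFiniteMeasure μ]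
    {φ : α → ℝ} (hφ : Measurable φ) {B : ℝ} (hB : ∀ x, |φ x| ≤ B) : Integrable φ μ :=
  Integrable.of_bound hφ.aestronglyMeasurable B (ae_of_all _ hB)

theorem abs_integral_le_of_abs_le {α : Type*} [MeasurableSpace α] {μ : Measure α}
    [IsProbabilityMeasure μ] {φ : α → ℝ} {B : ℝ} (hB : ∀ᵐ x ∂μ, |φ x| ≤ B) :
    |∫ x, φ x ∂μ| ≤ B := by
  simpa using norm_integral_le_of_norm_le_const (μ := μ) (f := φ) hB

theorem abs_integral_le_integral {α : Type*} [MeasurableSpace α] {μ : Measure α}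
    {φ ψ : α → ℝ} (hψ : Integrable ψ μ) (h : ∀ x, |φ x| ≤ ψ x) : |∫ x, φ x ∂μ| ≤ ∫ x, ψ x ∂μ :=
  norm_integral_le_of_norm_le (f := φ) hψ (ae_of_all _ h)

theorem measurable_OU {g : EuclideanSpace ℝ (Fin d) → ℝ} (hg : Measurable g) :
    Measurable (OU d ρ g) := by
  have : Measurable fun p : EuclideanSpace ℝ (Fin d) × EuclideanSpace ℝ (Fin d) =>
      g (ρ • p.1 + √(1 - ρ ^ 2) • p.2) := hg.comp (by fun_prop)
  exact (this.stronglyMeasurable.integral_prod_right (ν := gauss d)).measurable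

theorem abs_OU_le {g : EuclideanSpace ℝ (Fin d) → ℝ} {B : ℝ} (hB : ∀ x, |g x| ≤ B)
    (x : EuclideanSpace ℝ (Fin d)) : |OU d ρ g x| ≤ B :=
  abs_integral_le_of_abs_le (ae_of_all _ fun _ => hB _)

theorem OU_add (g : EuclideanSpace ℝ (Fin d) → ℝ) (x w : EuclideanSpace ℝ (Fin d)) :
    OU d ρ g (x + w) = OU d ρ (fun y => g (y + ρ • w)) x := by
  simp only [OU]
  congr 1
  ext y
  congr 1
  module

theorem OU_sub {f g : EuclideanSpace ℝ (Fin d) → ℝ} (hf : Measurable f) (hg : Measurable g)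
    {B : ℝ} (hfB : ∀ x, |f x| ≤ B) (hgB : ∀ x, |g x| ≤ B) (x : EuclideanSpace ℝ (Fin d)) :
    OU d ρ (fun y => f y - g y) x = OU d ρ f x - OU d ρ g x :=
  integral_sub (integrable_of_abs_le (hf.comp (by fun_prop)) fun _ => hfB _)
    (integrable_of_abs_le (hg.comp (by fun_prop)) fun _ => hgB _)

theorem integral_mul_OU_eq_prod {f g : EuclideanSpace ℝ (Fin d) → ℝ} (hf : Measurable f)
    (hg : Measurable g) {B : ℝ} (hfB : ∀ x, |f x| ≤ B) (hgB : ∀ x, |g x| ≤ B) :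
    ∫ x, f x * OU d ρ g x ∂(gauss d) =
      ∫ p, f p.1 * g (ρ • p.1 + √(1 - ρ ^ 2) • p.2) ∂((gauss d).prod (gauss d)) := by
  rw [integral_prod]
  · simp only [OU, integral_const_mul]
  · refine integrable_of_abs_le (B := B * B) ?_ fun p => ?_
    · exact (hf.comp measurable_fst).mul (hg.comp (by fun_prop))
    · rw [abs_mul]
      exact mul_le_mul (hfB _) (hgB _) (abs_nonneg _) ((abs_nonneg _).trans (hfB 0))

theorem integral_mul_OU_comm (h1 : -1 ≤ ρ) (h2 : ρ ≤ 1)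
    {f g : EuclideanSpace ℝ (Fin d) → ℝ} (hf : Measurable f)
    (hg : Measurable g) {B : ℝ} (hfB : ∀ x, |f x| ≤ B) (hgB : ∀ x, |g x| ≤ B) :
    ∫ x, f x * OU d ρ g x ∂(gauss d) = ∫ x, g x * OU d ρ f x ∂(gauss d) := by
  rw [integral_mul_OU_eq_prod hf hg hfB hgB, integral_mul_OU_eq_prod hg hf hgB hfB]
  rw [integral_gauss_prod_swap h1 h2 (φ := fun p => f p.1 * g p.2)
    ((hf.comp measurable_fst).mul (hg.comp measurable_snd))]
  simp only [mul_comm]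

end OU

/-! ### Maps into the simplex -/

section SimplexMap

variable {d m : ℕ} {ρ : ℝ} {f g : EuclideanSpace ℝ (Fin d) → Fin m → ℝ}

theorem SimplexMap.measurable_apply (hf : SimplexMap d m f) (i : Fin m) :
    Measurable fun x => f x i :=
  (measurable_pi_apply i).comp hf.1

theorem SimplexMap.nonneg (hf : SimplexMap d m f) (x : EuclideanSpace ℝ (Fin d)) (i : Fin m) :
    0 ≤ f x i := (hf.2 x).1 i

theorem SimplexMap.sum_eq (hf : SimplexMap d m f) (x : EuclideanSpace ℝ (Fin d)) :
    ∑ i, f x i = 1 := (hf.2 x).2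

theorem SimplexMap.le_one (hf : SimplexMap d m f) (x : EuclideanSpace ℝ (Fin d)) (i : Fin m) :
    f x i ≤ 1 := by
  rw [← hf.sum_eq x]
  exact Finset.single_le_sum (fun j _ => hf.nonneg x j) (Finset.mem_univ i)

theorem SimplexMap.abs_le (hf : SimplexMap d m f) (x : EuclideanSpace ℝ (Fin d)) (i : Fin m) :
    |f x i| ≤ 1 :=
  (abs_of_nonneg (hf.nonneg x i)).trans_le (hf.le_one x i)

theorem SimplexMap.comp (hf : SimplexMap d m f) {k : ℕ}
    {e : EuclideanSpace ℝ (Fin k) → EuclideanSpace ℝ (Fin d)} (he : Measurable e) :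
    SimplexMap k m (fun x => f (e x)) :=
  ⟨hf.1.comp he, fun x => hf.2 (e x)⟩

theorem SimplexMap.shift (hf : SimplexMap d m f) (w : EuclideanSpace ℝ (Fin d)) :
    SimplexMap d m (fun x => f (x + w)) :=
  hf.comp (by fun_prop)

theorem SimplexMap.ou (hf : SimplexMap d m f) :
    SimplexMap d m (fun x i => OU d ρ (fun y => f y i) x) := by
  refine ⟨measurable_pi_lambda _ fun i => measurable_OU (hf.measurable_apply i), fun x => ⟨
    fun i => integral_nonneg fun y => hf.nonneg _ i, ?_⟩⟩
  simp only [OU]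
  rw [← integral_finsetSum]
  · simp [hf.sum_eq]
  · exact fun i _ => integrable_of_abs_le ((hf.measurable_apply i).comp (by fun_prop))
      fun _ => hf.abs_le _ i

end SimplexMap

/-! ### Translation estimates -/

section Translation

variable {d : ℕ}

theorem abs_exp_sub_one_le (u : ℝ) : |Real.exp u - 1| ≤ |u| * Real.exp |u| := by
  have := Complex.norm_exp_sub_sum_le_norm_mul_exp (u : ℂ) 1
  simp only [Finset.range_one, Finset.sum_singleton, pow_zero, Nat.factorial_zero, Nat.cast_one,
    div_one, pow_one] at this
  rw [← Complex.ofReal_exp, ← Complex.ofReal_one, ← Complex.ofReal_sub, Complex.norm_real,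
    Complex.norm_real] at this
  exact this

theorem abs_exp_sub_one_sub_le (u : ℝ) : |Real.exp u - 1 - u| ≤ |u| ^ 2 * Real.exp |u| := by
  have := Complex.norm_exp_sub_sum_le_norm_mul_exp (u : ℂ) 2
  simp only [Finset.sum_range_succ, Finset.range_zero, Finset.sum_empty, pow_zero,
    Nat.factorial_zero, Nat.cast_one,
    div_one, pow_one, zero_add, Nat.factorial_one] at this
  rw [← sub_sub, ← Complex.ofReal_exp, ← Complex.ofReal_one, ← Complex.ofReal_sub,
    ← Complex.ofReal_sub, Complex.norm_real, Complex.norm_real] at this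
  exact this

theorem integrable_exp_inner (v : EuclideanSpace ℝ (Fin d)) :
    Integrable (fun x => Real.exp (inner ℝ v x)) (gauss d) := by
  have h := integral_gauss_add (fun _ => (1 : ℝ)) v
  have h2 : Integrable (fun x => Real.exp (inner ℝ v x - ‖v‖ ^ 2 / 2) • (1 : ℝ)) (gauss d) := by
    by_contra hn
    rw [integral_undef hn] at h
    simp at h
  refine (h2.const_mul (Real.exp (‖v‖ ^ 2 / 2))).congr (ae_of_all _ fun x => ?_)
  simp only [smul_eq_mul, mul_one]
  rw [← Real.exp_add]
  ring_nf

theorem integrable_tiltMajorant (v : EuclideanSpace ℝ (Fin d)) :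
    Integrable (fun x => (|inner ℝ v x| + 1) ^ 2 * Real.exp (|inner ℝ v x| + 1)) (gauss d) := by
  refine (((integrable_exp_inner ((2 : ℝ) • v)).add
    (integrable_exp_inner ((-2 : ℝ) • v))).const_mul (2 * Real.exp 2)).mono' (by fun_prop)
    (ae_of_all _ fun x => ?_)
  rw [Real.norm_of_nonneg (by positivity)]
  simp only [Pi.add_apply, inner_smul_left]
  set z := inner ℝ v x
  have hz := Real.quadratic_le_exp_of_nonneg (x := |z| + 1) (by positivity)
  have h1 : (|z| + 1) ^ 2 ≤ 2 * Real.exp (|z| + 1) := by nlinarith [abs_nonneg z]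
  calc _ ≤ 2 * Real.exp (|z| + 1) * Real.exp (|z| + 1) := by gcongr
    _ = 2 * Real.exp 2 * Real.exp (2 * |z|) := by
        rw [mul_assoc, mul_assoc, ← Real.exp_add, ← Real.exp_add]; ring_nf
    _ ≤ _ := by
        gcongr
        rcases abs_cases z with ⟨h, _⟩ | ⟨h, _⟩ <;> rw [h]
        · simp; positivity
        · simp; positivity

theorem integrable_inner_mul (v : EuclideanSpace ℝ (Fin d)) {φ : EuclideanSpace ℝ (Fin d) → ℝ}
    (hφ : Measurable φ) {B : ℝ} (hB : ∀ x, |φ x| ≤ B) :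
    Integrable (fun x => inner ℝ v x * φ x) (gauss d) := by
  refine Integrable.mul_bdd (c := B) ?_ hφ.aestronglyMeasurable (ae_of_all _ hB)
  refine (integrable_tiltMajorant v).mono' (by fun_prop) (ae_of_all _ fun x => ?_)
  rw [Real.norm_eq_abs]
  set z := inner ℝ v x
  have := Real.one_le_exp (x := |z| + 1) (by positivity)
  nlinarith [abs_nonneg z]

/-- Translating a bounded function changes its Gaussian mean by an amount which is Lipschitz in the
translation, and whose first-order term is given by Gaussian integration by parts. -/
theorem exists_translation_bound {v : EuclideanSpace ℝ (Fin d)} (hv : ‖v‖ = 1) :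
    ∃ C, 0 ≤ C ∧ ∀ φ : EuclideanSpace ℝ (Fin d) → ℝ, Measurable φ → ∀ B, (∀ x, |φ x| ≤ B) →
      ∀ s : ℝ, |∫ x, φ (x + s • v) ∂(gauss d) - ∫ x, φ x ∂(gauss d)| ≤ C * B * |s| ∧
      |∫ x, φ (x + s • v) ∂(gauss d) - ∫ x, φ x ∂(gauss d) -
        s * ∫ x, inner ℝ v x * φ x ∂(gauss d)| ≤ C * B * s ^ 2 := by
  set Φ : EuclideanSpace ℝ (Fin d) → ℝ :=
    fun x => (|inner ℝ v x| + 1) ^ 2 * Real.exp (|inner ℝ v x| + 1) with hΦ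
  have hΦi : Integrable Φ (gauss d) := integrable_tiltMajorant v
  have hΦ0 : 0 ≤ ∫ x, Φ x ∂(gauss d) := integral_nonneg fun x => by positivity
  refine ⟨2 * (∫ x, Φ x ∂(gauss d)) + 2, by positivity, fun φ hφ B hB s => ?_⟩
  have hB0 : 0 ≤ B := (abs_nonneg _).trans (hB 0)
  have hφi : Integrable φ (gauss d) := integrable_of_abs_le hφ hB
  have hXi := integrable_inner_mul v hφ hB
  have hΦX : ∀ x, |inner ℝ v x| ≤ Φ x := fun x => by
    have := Real.one_le_exp (x := |inner ℝ v x| + 1) (by positivity)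
    simp only [hΦ]
    nlinarith [abs_nonneg (inner ℝ v x)]
  have hXle : |∫ x, inner ℝ v x * φ x ∂(gauss d)| ≤ (∫ x, Φ x ∂(gauss d)) * B := by
    rw [← integral_mul_const]
    refine abs_integral_le_integral (hΦi.mul_const B) fun x => ?_
    rw [abs_mul]
    exact mul_le_mul (hΦX x) (hB x) (abs_nonneg _) ((abs_nonneg _).trans (hΦX x))
  have hle1 : |∫ x, φ (x + s • v) ∂(gauss d)| ≤ B :=
    abs_integral_le_of_abs_le (ae_of_all _ fun _ => hB _)
  have hle2 : |∫ x, φ x ∂(gauss d)| ≤ B := abs_integral_le_of_abs_le (ae_of_all _ fun _ => hB _)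
  rcases le_or_gt 1 |s| with hs | hs
  · have hs2 : |s| ≤ s ^ 2 := by rw [← sq_abs]; nlinarith
    have h1 : |∫ x, φ (x + s • v) ∂(gauss d) - ∫ x, φ x ∂(gauss d)| ≤ 2 * B :=
      (abs_sub _ _).trans (by linarith)
    have h3 : 0 ≤ (∫ x, Φ x ∂(gauss d)) * B := by positivity
    constructor
    · nlinarith [mul_nonneg h3 (abs_nonneg s)]
    · refine (abs_sub _ _).trans ?_
      rw [abs_mul]
      have h4 : |s| * |∫ x, inner ℝ v x * φ x ∂(gauss d)| ≤ s ^ 2 * ((∫ x, Φ x ∂(gauss d)) * B) :=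
        mul_le_mul hs2 hXle (abs_nonneg _) (sq_nonneg _)
      nlinarith [mul_nonneg h3 (sq_nonneg s)]
  · have htilt : ∫ x, φ (x + s • v) ∂(gauss d) =
        ∫ x, Real.exp (s * inner ℝ v x - s ^ 2 / 2) * φ x ∂(gauss d) := by
      rw [integral_gauss_add]
      simp [inner_smul_left, norm_smul, hv]
    have hexpi : Integrable (fun x => Real.exp (s * inner ℝ v x - s ^ 2 / 2) * φ x)
        (gauss d) := by
      refine Integrable.mul_bdd (c := B) ?_ hφ.aestronglyMeasurable (ae_of_all _ hB)
      refine ((integrable_exp_inner (s • v)).const_mul (Real.exp (-(s ^ 2 / 2)))).congr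
        (ae_of_all _ fun x => ?_)
      simp only [inner_smul_left, ← Real.exp_add]
      congr 1
      simp
      ring
    have hu : ∀ x, |s * inner ℝ v x - s ^ 2 / 2| ≤ |s| * (|inner ℝ v x| + 1) := fun x => by
      refine (abs_sub _ _).trans ?_
      rw [abs_mul, abs_of_nonneg (by positivity : 0 ≤ s ^ 2 / 2), ← sq_abs s]
      nlinarith [abs_nonneg s]
    have hu' : ∀ x, |s * inner ℝ v x - s ^ 2 / 2| ≤ |inner ℝ v x| + 1 := fun x =>
      (hu x).trans (by nlinarith [abs_nonneg (inner ℝ v x)])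
    constructor
    · rw [htilt, ← integral_sub hexpi hφi]
      calc _ ≤ ∫ x, Φ x * (|s| * B) ∂(gauss d) := by
            refine abs_integral_le_integral (hΦi.mul_const _) fun x => ?_
            rw [← sub_one_mul, abs_mul]
            have : |Real.exp (s * inner ℝ v x - s ^ 2 / 2) - 1| ≤ Φ x * |s| := by
              calc _ ≤ |s * inner ℝ v x - s ^ 2 / 2| * Real.exp |s * inner ℝ v x - s ^ 2 / 2| :=
                    abs_exp_sub_one_le _
                _ ≤ (|s| * (|inner ℝ v x| + 1)) * Real.exp (|inner ℝ v x| + 1) := by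
                    gcongr
                    · exact hu x
                    · exact hu' x
                _ ≤ (|s| * (|inner ℝ v x| + 1) ^ 2) * Real.exp (|inner ℝ v x| + 1) := by
                    gcongr
                    nlinarith [abs_nonneg (inner ℝ v x)]
                _ = _ := by simp only [hΦ]; ring
            rw [← mul_assoc]
            exact mul_le_mul this (hB x) (abs_nonneg _) ((abs_nonneg _).trans this)
        _ ≤ _ := by
            rw [integral_mul_const]
            nlinarith [mul_nonneg hB0 (abs_nonneg s), mul_nonneg hΦ0 (mul_nonneg hB0 (abs_nonneg s))]
    · have hsub : Integrable
          (fun x => Real.exp (s * inner ℝ v x - s ^ 2 / 2) * φ x - φ x) (gauss d) := hexpi.sub hφi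
      rw [htilt, ← integral_sub hexpi hφi, ← integral_const_mul,
        ← integral_sub hsub (hXi.const_mul s)]
      calc _ ≤ ∫ x, Φ x * (2 * s ^ 2 * B) ∂(gauss d) := by
            refine abs_integral_le_integral (hΦi.mul_const _) fun x => ?_
            have hrw : Real.exp (s * inner ℝ v x - s ^ 2 / 2) * φ x - φ x - s * (inner ℝ v x * φ x)
              = (Real.exp (s * inner ℝ v x - s ^ 2 / 2) - 1 - s * inner ℝ v x) * φ x := by ring
            rw [hrw, abs_mul]
            have hΦ1 : 1 ≤ Φ x := by
              have := Real.one_le_exp (x := |inner ℝ v x| + 1) (by positivity)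
              simp only [hΦ]
              nlinarith [abs_nonneg (inner ℝ v x), sq_nonneg (|inner ℝ v x|)]
            have : |Real.exp (s * inner ℝ v x - s ^ 2 / 2) - 1 - s * inner ℝ v x| ≤
                Φ x * (2 * s ^ 2) := by
              have h1 : |Real.exp (s * inner ℝ v x - s ^ 2 / 2) - 1 -
                  (s * inner ℝ v x - s ^ 2 / 2)| ≤ Φ x * s ^ 2 := by
                calc _ ≤ |s * inner ℝ v x - s ^ 2 / 2| ^ 2 *
                    Real.exp |s * inner ℝ v x - s ^ 2 / 2| := abs_exp_sub_one_sub_le _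
                  _ ≤ (|s| * (|inner ℝ v x| + 1)) ^ 2 * Real.exp (|inner ℝ v x| + 1) := by
                      gcongr
                      · exact hu x
                      · exact hu' x
                  _ = _ := by simp only [hΦ, mul_pow, sq_abs]; ring
              rw [abs_le] at h1 ⊢
              constructor <;> nlinarith [sq_nonneg s]
            rw [← mul_assoc]
            exact mul_le_mul this (hB x) (abs_nonneg _) ((abs_nonneg _).trans this)
        _ ≤ _ := by
            rw [integral_mul_const]
            nlinarith [mul_nonneg hB0 (sq_nonneg s)]

/-- Translates of a bounded nonnegative function are controlled in `L¹` by its `L²` norm. -/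
theorem integral_shift_le {v : EuclideanSpace ℝ (Fin d)} (hv : ‖v‖ = 1)
    {φ : EuclideanSpace ℝ (Fin d) → ℝ} (hφ : Measurable φ) {B : ℝ} (hB : ∀ x, |φ x| ≤ B)
    {ε : ℝ} (hε : 0 < ε) (a : ℝ) :
    ∫ x, φ (x + a • v) ∂(gauss d) ≤
      (∫ x, φ x ^ 2 ∂(gauss d)) / ε + ε * Real.exp (a ^ 2) := by
  have hsq : ∀ x, Real.exp (a * inner ℝ v x - a ^ 2 / 2) ^ 2 =
      Real.exp (a ^ 2) * Real.exp (inner ℝ ((2 * a) • v) x - ‖(2 * a) • v‖ ^ 2 / 2) := fun x => by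
    rw [← Real.exp_nat_mul, ← Real.exp_add]
    congr 1
    simp [inner_smul_left, norm_smul, hv, mul_pow]
    ring
  have hone := integral_gauss_add (fun _ => (1 : ℝ)) ((2 * a) • v)
  simp only [integral_const, smul_eq_mul, mul_one, probReal_univ] at hone
  have hi : Integrable (fun x => Real.exp (inner ℝ ((2 * a) • v) x - ‖(2 * a) • v‖ ^ 2 / 2))
      (gauss d) := by
    by_contra hn
    rw [integral_undef hn] at hone
    simp at hone
  have hi2 : Integrable (fun x => φ x ^ 2) (gauss d) :=
    integrable_of_abs_le (hφ.pow_const 2) (B := B ^ 2) fun x => by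
      rw [abs_pow]; gcongr; exact hB x
  rw [integral_gauss_add]
  calc _ ≤ ∫ x, (φ x ^ 2 / ε + ε * (Real.exp (a ^ 2) *
        Real.exp (inner ℝ ((2 * a) • v) x - ‖(2 * a) • v‖ ^ 2 / 2))) ∂(gauss d) := by
        refine (le_abs_self _).trans (abs_integral_le_integral
          ((hi2.div_const _).add ((hi.const_mul _).const_mul _)) fun x => ?_)
        rw [← hsq]
        simp only [inner_smul_left, norm_smul, hv, smul_eq_mul, abs_mul, Real.abs_exp]
        set w := Real.exp (a * inner ℝ v x - a ^ 2 / 2) with hw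
        have hw' : Real.exp ((starRingEnd ℝ) a * inner ℝ v x - (‖a‖ * 1) ^ 2 / 2) = w := by
          simp [hw]
        rw [hw', ← sq_abs (φ x)]
        have h := sq_nonneg (|φ x| / ε - w)
        have h2 : |φ x| ^ 2 / ε + ε * w ^ 2 - w * |φ x| =
            ε * ((|φ x| / ε - w) ^ 2 + (|φ x| / ε) * w) := by field_simp; ring
        have h3 : 0 ≤ ε * ((|φ x| / ε - w) ^ 2 + (|φ x| / ε) * w) := by positivity
        linarith
    _ = _ := by
        rw [integral_add (hi2.div_const _) ((hi.const_mul _).const_mul _), integral_div,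
          integral_const_mul, integral_const_mul, ← hone, mul_one]

end Translation

/-! ### Weak compactness -/

section WeakCompactness

theorem integral_mul_indicator_one {α : Type*} [MeasurableSpace α] {μ : Measure α} (H : α → ℝ)
    {s : Set α} (hs : MeasurableSet s) :
    ∫ x, H x * s.indicator (fun _ => 1) x ∂μ = ∫ x in s, H x ∂μ := by
  rw [← integral_indicator hs]
  congr 1
  ext x
  by_cases hx : x ∈ s <;> simp [hx]

theorem exists_weak_limit {α : Type*} [MeasurableSpace α] [MeasurableSpace.CountablyGenerated α]
    {μ : Measure α} [IsFiniteMeasure μ] (F : ℕ → α → ℝ) (hF : ∀ n, Measurable (F n))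
    (h0 : ∀ n x, 0 ≤ F n x) (h1 : ∀ n x, F n x ≤ 1) :
    ∃ φ : ℕ → ℕ, StrictMono φ ∧ ∃ G : α → ℝ, Measurable G ∧ (∀ x, 0 ≤ G x) ∧ (∀ x, G x ≤ 1) ∧
      ∀ u : α → ℝ, Integrable u μ →
        Tendsto (fun n => ∫ x, F (φ n) x * u x ∂μ) atTop (𝓝 (∫ x, G x * u x ∂μ)) := by
  have : Fact ((2 : ℝ≥0∞) ≠ ∞) := ⟨by simp⟩
  have hFabs : ∀ n x, |F n x| ≤ 1 := fun n x => abs_le.2 ⟨by linarith [h0 n x], h1 n x⟩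
  have hmem : ∀ n, MemLp (F n) 2 μ := fun n =>
    MemLp.of_bound (hF n).aestronglyMeasurable 1 (ae_of_all _ (hFabs n))
  let a : ℕ → Lp ℝ 2 μ := fun n => (hmem n).toLp
  obtain ⟨R, hR⟩ : ∃ R : ℝ, ∀ n, ‖a n‖ ≤ R :=
    ⟨_, fun n => Lp.norm_le_of_ae_bound zero_le_one ((hmem n).coeFn_toLp.mono fun x hx => by
      rw [hx]; exact hFabs n x)⟩
  obtain ⟨ℓ, -, φ, hφ, hlim⟩ := WeakDual.isSeqCompact_closedBall ℝ (Lp ℝ 2 μ) 0 R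
    (x := fun n => StrongDual.toWeakDual (InnerProductSpace.toDual ℝ (Lp ℝ 2 μ) (a n)))
    (fun n => by simpa using hR n)
  let b : Lp ℝ 2 μ := (InnerProductSpace.toDual ℝ (Lp ℝ 2 μ)).symm (WeakDual.toStrongDual ℓ)
  have hweak : ∀ u : α → ℝ, MemLp u 2 μ →
      Tendsto (fun n => ∫ x, F (φ n) x * u x ∂μ) atTop (𝓝 (∫ x, b x * u x ∂μ)) := by
    intro u hu
    have h := ((WeakDual.eval_continuous (𝕜 := ℝ) (hu.toLp)).tendsto ℓ).comp hlim
    have e1 : ∀ n, (StrongDual.toWeakDual (InnerProductSpace.toDual ℝ (Lp ℝ 2 μ) (a n))) hu.toLp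
        = ∫ x, F n x * u x ∂μ := fun n => by
      change inner ℝ (a n) hu.toLp = _
      rw [L2.inner_def]
      refine integral_congr_ae ?_
      filter_upwards [(hmem n).coeFn_toLp, hu.coeFn_toLp] with x hx hx2
      rw [hx, hx2]
      simp [mul_comm]
    have e2 : ℓ hu.toLp = ∫ x, b x * u x ∂μ := by
      have : inner ℝ b hu.toLp = ℓ hu.toLp := by
        simp only [b, InnerProductSpace.toDual_symm_apply]
        rfl
      rw [← this, L2.inner_def]
      refine integral_congr_ae ?_
      filter_upwards [hu.coeFn_toLp] with x hx2
      rw [hx2]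
      simp [mul_comm]
    rw [e2] at h
    refine h.congr fun n => ?_
    exact e1 (φ n)
  have hbi : Integrable b μ := (Lp.memLp b).integrable one_le_two
  have hset : ∀ s, MeasurableSet s →
      Tendsto (fun n => ∫ x in s, F (φ n) x ∂μ) atTop (𝓝 (∫ x in s, b x ∂μ)) := fun s hs => by
    have := hweak (s.indicator fun _ => 1) ((memLp_const 1).indicator hs)
    simpa only [integral_mul_indicator_one _ hs] using this
  have hb0 : 0 ≤ᵐ[μ] b := ae_nonneg_of_forall_setIntegral_nonneg hbi fun s hs _ =>
    ge_of_tendsto' (hset s hs) fun n => integral_nonneg fun x => h0 _ x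
  have hb1 : b ≤ᵐ[μ] fun _ => (1 : ℝ) :=
    ae_le_of_forall_setIntegral_le hbi (integrable_const 1) fun s hs _ =>
      le_of_tendsto' (hset s hs) fun n => integral_mono
        (integrable_of_abs_le (hF _) (hFabs _)) (integrable_const 1) fun x => h1 _ x
  let G : α → ℝ := fun x => max 0 (min 1 (b x))
  have hGm : Measurable G :=
    measurable_const.max (measurable_const.min (Lp.stronglyMeasurable b).measurable)
  have hGb : G =ᵐ[μ] b := by
    filter_upwards [hb0, hb1] with x hx hx1
    simp only [G]
    rw [min_eq_right hx1]
    exact max_eq_right hx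
  have hG0 : ∀ x, 0 ≤ G x := fun x => le_max_left _ _
  have hG1 : ∀ x, G x ≤ 1 := fun x => max_le zero_le_one (min_le_left _ _)
  have hGabs : ∀ x, |G x| ≤ 1 := fun x => abs_le.2 ⟨by linarith [hG0 x], hG1 x⟩
  refine ⟨φ, hφ, G, hGm, hG0, hG1, fun u hu => ?_⟩
  rw [Metric.tendsto_atTop]
  intro ε hε
  obtain ⟨s, hs, -⟩ := (memLp_one_iff_integrable.2 hu).exists_simpleFunc_eLpNorm_sub_lt
    ENNReal.one_ne_top (ε := ENNReal.ofReal (ε / 3)) (by simpa using hε)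
  have hsi : Integrable s μ := memLp_one_iff_integrable.1 (SimpleFunc.memLp_of_isFiniteMeasure s 1 μ)
  have hus : ∫ x, |u x - s x| ∂μ < ε / 3 := by
    have := integral_norm_eq_lintegral_enorm (hu.sub hsi).aestronglyMeasurable
    rw [eLpNorm_one_eq_lintegral_enorm] at hs
    calc ∫ x, |u x - s x| ∂μ = (∫⁻ x, ‖(u - s) x‖ₑ ∂μ).toReal := this
      _ < ε / 3 := by
        rw [← ENNReal.toReal_ofReal (by positivity : 0 ≤ ε / 3)]
        exact (ENNReal.toReal_lt_toReal (ne_top_of_lt hs) ENNReal.ofReal_ne_top).2 hs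
  have hclose : ∀ H : α → ℝ, Measurable H → (∀ x, |H x| ≤ 1) →
      |∫ x, H x * u x ∂μ - ∫ x, H x * s x ∂μ| < ε / 3 := fun H hH hH1 => by
    rw [← integral_sub (hu.bdd_mul hH.aestronglyMeasurable (ae_of_all _ hH1))
      (hsi.bdd_mul hH.aestronglyMeasurable (ae_of_all _ hH1))]
    refine (abs_integral_le_integral (hu.sub hsi).abs fun x => ?_).trans_lt hus
    rw [← mul_sub, abs_mul]
    exact mul_le_of_le_one_left (abs_nonneg _) (hH1 x)
  have hs2 := hweak s (SimpleFunc.memLp_of_isFiniteMeasure s 2 μ)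
  have : ∫ x, b x * s x ∂μ = ∫ x, G x * s x ∂μ :=
    integral_congr_ae (hGb.mono fun x hx => by simp only [hx])
  rw [this, Metric.tendsto_atTop] at hs2
  obtain ⟨N, hN⟩ := hs2 (ε / 3) (by positivity)
  refine ⟨N, fun n hn => ?_⟩
  have k1 := abs_lt.1 (hclose (F (φ n)) (hF _) (hFabs _))
  have k2 := abs_lt.1 (hclose G hGm hGabs)
  have k3 := hN n hn
  rw [Real.dist_eq, abs_lt] at k3 ⊢
  constructor <;> linarith

variable {d m : ℕ} {ρ : ℝ}

/-- Weak convergence of maps into the simplex, tested against Gaussian-integrable functions. -/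
def WeakTendsto (F : ℕ → EuclideanSpace ℝ (Fin d) → Fin m → ℝ)
    (f : EuclideanSpace ℝ (Fin d) → Fin m → ℝ) : Prop :=
  ∀ i, ∀ u : EuclideanSpace ℝ (Fin d) → ℝ, Integrable u (gauss d) →
    Tendsto (fun n => ∫ x, F n x i * u x ∂(gauss d)) atTop (𝓝 (∫ x, f x i * u x ∂(gauss d)))

theorem WeakTendsto.comp {F : ℕ → EuclideanSpace ℝ (Fin d) → Fin m → ℝ}
    {f : EuclideanSpace ℝ (Fin d) → Fin m → ℝ} (h : WeakTendsto F f) {φ : ℕ → ℕ}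
    (hφ : StrictMono φ) : WeakTendsto (fun n => F (φ n)) f :=
  fun i u hu => (h i u hu).comp hφ.tendsto_atTop

theorem SimplexMap.exists_weakTendsto (F : ℕ → EuclideanSpace ℝ (Fin d) → Fin m → ℝ)
    (hF : ∀ n, SimplexMap d m (F n)) :
    ∃ φ : ℕ → ℕ, StrictMono φ ∧ ∃ f, SimplexMap d m f ∧ WeakTendsto (fun n => F (φ n)) f := by
  obtain ⟨φ, hφ, G, hG, hG0, hG1, hlim⟩ := exists_weak_limit
    (μ := (Measure.count : Measure (Fin m)).prod (gauss d)) (fun n p => F n p.2 p.1)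
    (fun n => measurable_from_prod_countable_right fun i => (hF n).measurable_apply i)
    (fun n p => (hF n).nonneg _ _) (fun n p => (hF n).le_one _ _)
  have hGm : ∀ i, Measurable fun x => G (i, x) := fun i => hG.comp measurable_prodMk_left
  have hGabs : ∀ p, |G p| ≤ 1 := fun p =>
    (abs_of_nonneg (hG0 p)).trans_le (hG1 p)
  have hweak : WeakTendsto (fun n => F (φ n)) (fun x i => G (i, x)) := by
    intro i u hu
    have hui : Integrable (fun p : Fin m × EuclideanSpace ℝ (Fin d) =>
        (if p.1 = i then (1 : ℝ) else 0) * u p.2)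
        ((Measure.count : Measure (Fin m)).prod (gauss d)) :=
      Integrable.mul_prod (f := fun j : Fin m => if j = i then (1 : ℝ) else 0)
        Integrable.of_finite hu
    have hrw : ∀ H : Fin m × EuclideanSpace ℝ (Fin d) → ℝ, Measurable H → (∀ p, |H p| ≤ 1) →
        ∫ p, H p * ((if p.1 = i then (1 : ℝ) else 0) * u p.2)
          ∂((Measure.count : Measure (Fin m)).prod (gauss d)) =
        ∫ x, H (i, x) * u x ∂(gauss d) := fun H hH hH1 => by
      rw [integral_prod _ (hui.bdd_mul hH.aestronglyMeasurable (ae_of_all _ hH1)),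
        integral_fintype Integrable.of_finite, Finset.sum_eq_single i]
      · simp
      · intro j _ hj
        simp [hj]
      · simp
    have := hlim _ hui
    rw [hrw G hG hGabs] at this
    refine this.congr fun n => ?_
    exact hrw (fun p => F (φ n) p.2 p.1)
      (measurable_from_prod_countable_right fun i => (hF _).measurable_apply i)
      (fun p => (hF _).abs_le _ _)
  have hsum : (fun x => ∑ i, G (i, x)) =ᵐ[gauss d] fun _ => (1 : ℝ) := by
    have hGi : ∀ i, Integrable (fun x => G (i, x)) (gauss d) := fun i =>
      integrable_of_abs_le (hGm i) fun x => hGabs _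
    refine Integrable.ae_eq_of_forall_setIntegral_eq _ _ (integrable_finsetSum _ fun i _ => hGi i)
      (integrable_const 1) fun s hs _ => ?_
    rw [integral_finsetSum _ fun i _ => (hGi i).integrableOn]
    have key := tendsto_finsetSum Finset.univ fun i _ => hweak i (s.indicator fun _ => 1)
      ((integrable_const 1).indicator hs)
    simp only [integral_mul_indicator_one _ hs] at key
    refine tendsto_nhds_unique key (tendsto_const_nhds.congr fun n => ?_)
    rw [← integral_finsetSum _ fun i _ =>
      (integrable_of_abs_le ((hF _).measurable_apply i) fun x => (hF _).abs_le x i)]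
    simp_rw [(hF (φ n)).sum_eq]
  classical
  refine ⟨φ, hφ, fun x => if ∑ i, G (i, x) = 1 then fun i => G (i, x) else F 0 x, ⟨?_, ?_⟩, ?_⟩
  · refine Measurable.ite ?_ (measurable_pi_lambda _ hGm) (hF 0).1
    exact (Finset.measurable_sum _ fun i _ => hGm i) (measurableSet_singleton 1)
  · intro x
    dsimp only
    split_ifs with h
    · exact ⟨fun i => hG0 _, h⟩
    · exact (hF 0).2 x
  · intro i u hu
    convert! hweak i u hu using 2
    refine integral_congr_ae (hsum.mono fun x hx => ?_)
    simp only
    rw [if_pos hx]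

theorem WeakTendsto.tendsto_OU (h1 : -1 < ρ) (h2 : ρ < 1)
    {F : ℕ → EuclideanSpace ℝ (Fin d) → Fin m → ℝ}
    {f : EuclideanSpace ℝ (Fin d) → Fin m → ℝ} (hF : ∀ n, SimplexMap d m (F n))
    (hf : SimplexMap d m f) (h : WeakTendsto F f) (i : Fin m) (x : EuclideanSpace ℝ (Fin d)) :
    Tendsto (fun n => OU d ρ (fun y => F n y i) x) atTop (𝓝 (OU d ρ (fun y => f y i) x)) := by
  have hc : √(1 - ρ ^ 2) ≠ 0 := (Real.sqrt_pos.2 (by nlinarith)).ne'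
  have hac := map_gauss_affine_absolutelyContinuous hc (ρ • x)
  set ν := (gauss d).map (fun y => ρ • x + √(1 - ρ ^ 2) • y) with hν
  have : IsProbabilityMeasure ν := Measure.isProbabilityMeasure_map (by fun_prop)
  have : SigmaFinite (gauss d) := inferInstance
  have : SFinite ν := inferInstance
  have : ν.HaveLebesgueDecomposition (gauss d) := inferInstance
  have hrw : ∀ H : EuclideanSpace ℝ (Fin d) → ℝ, Measurable H →
      OU d ρ H x = ∫ y, H y * (ν.rnDeriv (gauss d) y).toReal ∂(gauss d) := fun H hH => by
    rw [OU, ← integral_map (φ := fun y => ρ • x + √(1 - ρ ^ 2) • y) (f := H) (by fun_prop)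
      hH.aestronglyMeasurable, ← hν, ← integral_rnDeriv_smul hac]
    simp only [smul_eq_mul, mul_comm]
  rw [hrw _ (hf.measurable_apply i)]
  simp_rw [fun n => hrw _ ((hF n).measurable_apply i)]
  exact h i _ Measure.integrable_toReal_rnDeriv

theorem WeakTendsto.tendsto_Cmat (h1 : -1 < ρ) (h2 : ρ < 1)
    {F G : ℕ → EuclideanSpace ℝ (Fin d) → Fin m → ℝ}
    {f g : EuclideanSpace ℝ (Fin d) → Fin m → ℝ} (hF : ∀ n, SimplexMap d m (F n))
    (hG : ∀ n, SimplexMap d m (G n)) (hg : SimplexMap d m g)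
    (hFf : WeakTendsto F f) (hGg : WeakTendsto G g) (i j : Fin m) :
    Tendsto (fun n => Cmat d m ρ (F n) (G n) i j) atTop (𝓝 (Cmat d m ρ f g i j)) := by
  simp only [Cmat, Matrix.of_apply]
  have hgi : Integrable (OU d ρ fun y => g y j) (gauss d) :=
    integrable_of_abs_le (measurable_OU (hg.measurable_apply j))
      (abs_OU_le fun x => hg.abs_le x j)
  have hGi : ∀ n, Integrable (OU d ρ fun y => G n y j) (gauss d) := fun n =>
    integrable_of_abs_le (measurable_OU ((hG n).measurable_apply j))
      (abs_OU_le fun x => (hG n).abs_le x j)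
  have hA := hFf i _ hgi
  have hB : Tendsto (fun n => ∫ x, F n x i *
      (OU d ρ (fun y => G n y j) x - OU d ρ (fun y => g y j) x) ∂(gauss d)) atTop (𝓝 0) := by
    rw [← integral_zero (EuclideanSpace ℝ (Fin d)) ℝ (μ := gauss d)]
    refine tendsto_integral_of_dominated_convergence (fun _ => 2) (fun n => ?_)
      (integrable_const _) (fun n => ae_of_all _ fun x => ?_) (ae_of_all _ fun x => ?_)
    · exact (((hF n).measurable_apply i).mul ((measurable_OU ((hG n).measurable_apply j)).sub
        (measurable_OU (hg.measurable_apply j)))).aestronglyMeasurable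
    · rw [norm_mul]
      have e1 := abs_OU_le (ρ := ρ) (fun x => (hG n).abs_le x j) x
      have e2 := abs_OU_le (ρ := ρ) (fun x => hg.abs_le x j) x
      calc _ ≤ 1 * ‖OU d ρ (fun y => G n y j) x - OU d ρ (fun y => g y j) x‖ := by
            gcongr
            exact (hF n).abs_le x i
        _ ≤ 2 := by
            rw [one_mul]
            exact (abs_sub _ _).trans (by linarith)
    · have h0 := ((hGg.tendsto_OU h1 h2 hG hg j x).sub_const (OU d ρ (fun y => g y j) x))
      rw [sub_self] at h0
      refine squeeze_zero_norm (fun n => ?_) (by simpa using h0.norm)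
      rw [norm_mul]
      exact mul_le_of_le_one_left (norm_nonneg _) ((hF n).abs_le x i)
  have := hA.add hB
  rw [add_zero] at this
  refine this.congr fun n => ?_
  have hb : ∀ H : EuclideanSpace ℝ (Fin d) → ℝ, Integrable H (gauss d) →
      Integrable (fun x => F n x i * H x) (gauss d) := fun H hH =>
    hH.bdd_mul ((hF n).measurable_apply i).aestronglyMeasurable
      (ae_of_all _ fun x => (hF n).abs_le x i)
  refine (integral_add (hb _ hgi) (hb _ ((hGi n).sub hgi))).symm.trans ?_
  congr 1
  ext x
  simp only [Pi.sub_apply]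
  ring

end WeakCompactness

/-! ### Bounded measurable vector fields and the linear response operator -/

section Response

variable {d m : ℕ} {ρ : ℝ}

/-- A measurable vector-valued function with uniformly bounded components. -/
structure BddMeasurable (F : EuclideanSpace ℝ (Fin d) → Fin m → ℝ) : Prop where
  measurable_apply : ∀ i, Measurable fun x => F x i
  exists_bound : ∃ B, ∀ x i, |F x i| ≤ B

/-- The Ornstein–Uhlenbeck operator applied componentwise, followed by a matrix. -/
noncomputable def response (ρ : ℝ) (A : Matrix (Fin m) (Fin m) ℝ)
    (g : EuclideanSpace ℝ (Fin d) → Fin m → ℝ) (x : EuclideanSpace ℝ (Fin d)) : Fin m → ℝ :=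
  fun i => ∑ j, A i j * OU d ρ (fun y => g y j) x

variable {F G : EuclideanSpace ℝ (Fin d) → Fin m → ℝ} {A : Matrix (Fin m) (Fin m) ℝ}

theorem SimplexMap.bddMeasurable (hF : SimplexMap d m F) : BddMeasurable F :=
  ⟨hF.measurable_apply, 1, hF.abs_le⟩

theorem BddMeasurable.add (hF : BddMeasurable F) (hG : BddMeasurable G) :
    BddMeasurable fun x => F x + G x := by
  obtain ⟨B, hB⟩ := hF.exists_bound
  obtain ⟨C, hC⟩ := hG.exists_bound
  exact ⟨fun i => (hF.measurable_apply i).add (hG.measurable_apply i), B + C,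
    fun x i => (abs_add_le _ _).trans (add_le_add (hB x i) (hC x i))⟩

theorem BddMeasurable.sub (hF : BddMeasurable F) (hG : BddMeasurable G) :
    BddMeasurable fun x => F x - G x := by
  obtain ⟨B, hB⟩ := hF.exists_bound
  obtain ⟨C, hC⟩ := hG.exists_bound
  exact ⟨fun i => (hF.measurable_apply i).sub (hG.measurable_apply i), B + C,
    fun x i => (abs_sub _ _).trans (add_le_add (hB x i) (hC x i))⟩

theorem BddMeasurable.const_smul (hF : BddMeasurable F) (c : ℝ) :
    BddMeasurable fun x => c • F x := by
  obtain ⟨B, hB⟩ := hF.exists_bound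
  refine ⟨fun i => (hF.measurable_apply i).const_mul c, |c| * B, fun x i => ?_⟩
  rw [Pi.smul_apply, smul_eq_mul, abs_mul]
  exact mul_le_mul_of_nonneg_left (hB x i) (abs_nonneg c)

theorem BddMeasurable.shift (hF : BddMeasurable F) (w : EuclideanSpace ℝ (Fin d)) :
    BddMeasurable fun x => F (x + w) := by
  obtain ⟨B, hB⟩ := hF.exists_bound
  exact ⟨fun i => (hF.measurable_apply i).comp (measurable_add_const w), B, fun x i => hB _ i⟩

theorem BddMeasurable.measurable_dotProduct (hF : BddMeasurable F) (hG : BddMeasurable G) :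
    Measurable fun x => F x ⬝ᵥ G x :=
  Finset.measurable_sum _ fun i _ => (hF.measurable_apply i).mul (hG.measurable_apply i)

theorem BddMeasurable.integrable_mul (hF : BddMeasurable F) (hG : BddMeasurable G) (i j : Fin m) :
    Integrable (fun x => F x i * G x j) (gauss d) := by
  obtain ⟨B, hB⟩ := hF.exists_bound
  obtain ⟨C, hC⟩ := hG.exists_bound
  refine integrable_of_abs_le (B := B * C)
    ((hF.measurable_apply i).mul (hG.measurable_apply j)) fun x => ?_
  rw [abs_mul]
  exact mul_le_mul (hB x i) (hC x j) (abs_nonneg _) ((abs_nonneg _).trans (hB x i))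

theorem BddMeasurable.integrable_dotProduct (hF : BddMeasurable F) (hG : BddMeasurable G) :
    Integrable (fun x => F x ⬝ᵥ G x) (gauss d) :=
  integrable_finsetSum _ fun i _ => hF.integrable_mul hG i i

section Bilinear

variable {H : EuclideanSpace ℝ (Fin d) → Fin m → ℝ}

theorem integral_add_dotProduct (hF : BddMeasurable F) (hG : BddMeasurable G)
    (hH : BddMeasurable H) :
    ∫ x, (F x + G x) ⬝ᵥ H x ∂(gauss d) =
      ∫ x, F x ⬝ᵥ H x ∂(gauss d) + ∫ x, G x ⬝ᵥ H x ∂(gauss d) := by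
  simp only [add_dotProduct]
  exact integral_add (hF.integrable_dotProduct hH) (hG.integrable_dotProduct hH)

theorem integral_sub_dotProduct (hF : BddMeasurable F) (hG : BddMeasurable G)
    (hH : BddMeasurable H) :
    ∫ x, (F x - G x) ⬝ᵥ H x ∂(gauss d) =
      ∫ x, F x ⬝ᵥ H x ∂(gauss d) - ∫ x, G x ⬝ᵥ H x ∂(gauss d) := by
  simp only [sub_dotProduct]
  exact integral_sub (hF.integrable_dotProduct hH) (hG.integrable_dotProduct hH)

theorem integral_dotProduct_sub (hF : BddMeasurable F) (hG : BddMeasurable G)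
    (hH : BddMeasurable H) :
    ∫ x, H x ⬝ᵥ (F x - G x) ∂(gauss d) =
      ∫ x, H x ⬝ᵥ F x ∂(gauss d) - ∫ x, H x ⬝ᵥ G x ∂(gauss d) := by
  simp only [dotProduct_sub]
  exact integral_sub (hH.integrable_dotProduct hF) (hH.integrable_dotProduct hG)

theorem integral_dotProduct_add (hF : BddMeasurable F) (hG : BddMeasurable G)
    (hH : BddMeasurable H) :
    ∫ x, H x ⬝ᵥ (F x + G x) ∂(gauss d) =
      ∫ x, H x ⬝ᵥ F x ∂(gauss d) + ∫ x, H x ⬝ᵥ G x ∂(gauss d) := by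
  simp only [dotProduct_add]
  exact integral_add (hH.integrable_dotProduct hF) (hH.integrable_dotProduct hG)

theorem integral_smul_dotProduct (c : ℝ) :
    ∫ x, (c • F x) ⬝ᵥ H x ∂(gauss d) = c * ∫ x, F x ⬝ᵥ H x ∂(gauss d) := by
  simp only [smul_dotProduct, smul_eq_mul]
  exact integral_const_mul _ _

theorem integral_dotProduct_smul (c : ℝ) :
    ∫ x, H x ⬝ᵥ (c • F x) ∂(gauss d) = c * ∫ x, H x ⬝ᵥ F x ∂(gauss d) := by
  simp only [dotProduct_smul, smul_eq_mul]
  exact integral_const_mul _ _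

theorem integral_dotProduct_comm (F G : EuclideanSpace ℝ (Fin d) → Fin m → ℝ) :
    ∫ x, F x ⬝ᵥ G x ∂(gauss d) = ∫ x, G x ⬝ᵥ F x ∂(gauss d) := by
  simp only [dotProduct_comm]

end Bilinear

theorem BddMeasurable.ou (hG : BddMeasurable G) :
    BddMeasurable fun x j => OU d ρ (fun y => G y j) x := by
  obtain ⟨B, hB⟩ := hG.exists_bound
  exact ⟨fun j => measurable_OU (hG.measurable_apply j), B, fun x j => abs_OU_le (fun y => hB y j) x⟩

theorem BddMeasurable.response (hG : BddMeasurable G) (A : Matrix (Fin m) (Fin m) ℝ) :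
    BddMeasurable (response ρ A G) := by
  obtain ⟨B, hB⟩ := (hG.ou (ρ := ρ)).exists_bound
  refine ⟨fun i => Finset.measurable_sum _ fun j _ =>
    (measurable_OU (hG.measurable_apply j)).const_mul _, ∑ i, ∑ j, |A i j| * |B|, fun x i => ?_⟩
  refine (Finset.abs_sum_le_sum_abs _ _).trans ?_
  refine le_trans ?_ (Finset.single_le_sum (f := fun i => ∑ j, |A i j| * |B|)
    (fun i _ => by positivity) (Finset.mem_univ i))
  gcongr with j
  rw [abs_mul]
  exact mul_le_mul_of_nonneg_left ((hB x j).trans (le_abs_self _)) (abs_nonneg _)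

theorem response_add_right (A : Matrix (Fin m) (Fin m) ℝ) (x w : EuclideanSpace ℝ (Fin d)) :
    response ρ A G (x + w) = response ρ A (fun y => G (y + ρ • w)) x := by
  ext i
  simp only [response, OU_add]

theorem response_sub (hF : BddMeasurable F) (hG : BddMeasurable G)
    (A : Matrix (Fin m) (Fin m) ℝ) (x : EuclideanSpace ℝ (Fin d)) :
    response ρ A (fun y => F y - G y) x = response ρ A F x - response ρ A G x := by
  obtain ⟨B, hB⟩ := hF.exists_bound
  obtain ⟨C, hC⟩ := hG.exists_bound
  ext i
  simp only [response, Pi.sub_apply]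
  rw [← Finset.sum_sub_distrib]
  refine Finset.sum_congr rfl fun j _ => ?_
  rw [OU_sub (B := max B C) (hF.measurable_apply j) (hG.measurable_apply j)
    (fun x => (hB x j).trans (le_max_left _ _)) (fun x => (hC x j).trans (le_max_right _ _)),
    mul_sub]

theorem integral_dotProduct_response (hF : BddMeasurable F) (hG : BddMeasurable G)
    (A : Matrix (Fin m) (Fin m) ℝ) :
    ∫ x, F x ⬝ᵥ response ρ A G x ∂(gauss d) = ∑ i, ∑ j, A i j * Cmat d m ρ F G i j := by
  simp only [dotProduct, response, Finset.mul_sum]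
  rw [integral_finsetSum]
  · refine Finset.sum_congr rfl fun i _ => ?_
    rw [integral_finsetSum]
    · refine Finset.sum_congr rfl fun j _ => ?_
      simp only [Cmat, Matrix.of_apply]
      rw [← integral_const_mul]
      congr 1
      ext x
      ring
    · intro j _
      simpa [mul_left_comm] using (hF.integrable_mul (hG.ou (ρ := ρ)) i j).const_mul (A i j)
  · intro i _
    refine integrable_finsetSum _ fun j _ => ?_
    simpa [mul_left_comm] using (hF.integrable_mul (hG.ou (ρ := ρ)) i j).const_mul (A i j)

theorem Cmat_transpose (h1 : -1 ≤ ρ) (h2 : ρ ≤ 1) (hF : BddMeasurable F) (hG : BddMeasurable G)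
    (i j : Fin m) : Cmat d m ρ F G i j = Cmat d m ρ G F j i := by
  obtain ⟨B, hB⟩ := hF.exists_bound
  obtain ⟨C, hC⟩ := hG.exists_bound
  simp only [Cmat, Matrix.of_apply]
  exact integral_mul_OU_comm (B := max B C) h1 h2 (hF.measurable_apply i) (hG.measurable_apply j)
    (fun x => (hB x i).trans (le_max_left _ _)) (fun x => (hC x j).trans (le_max_right _ _))

theorem integral_dotProduct_response_comm (h1 : -1 ≤ ρ) (h2 : ρ ≤ 1) (hF : BddMeasurable F)
    (hG : BddMeasurable G) (A : Matrix (Fin m) (Fin m) ℝ) :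
    ∫ x, F x ⬝ᵥ response ρ A G x ∂(gauss d) =
      ∫ x, G x ⬝ᵥ response ρ A.transpose F x ∂(gauss d) := by
  rw [integral_dotProduct_response hF hG, integral_dotProduct_response hG hF, Finset.sum_comm]
  simp only [Matrix.transpose_apply, Cmat_transpose h1 h2 hF hG]

end Response

/-! ### Lipschitz bounds along a direction -/

section Regularity

variable {d m : ℕ} {ρ : ℝ}

theorem exists_OU_translation_bound (h1 : -1 < ρ) (h2 : ρ < 1) {v : EuclideanSpace ℝ (Fin d)}
    (hv : ‖v‖ = 1) :
    ∃ L, 0 ≤ L ∧ ∀ g : EuclideanSpace ℝ (Fin d) → ℝ, Measurable g → (∀ x, |g x| ≤ 1) →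
      ∀ x, (∀ t : ℝ, |OU d ρ g (x + t • v) - OU d ρ g x| ≤ L * |t|) ∧
        ∃ D : ℝ, ∀ t : ℝ, |OU d ρ g (x + t • v) - OU d ρ g x - t * D| ≤ L * t ^ 2 := by
  obtain ⟨C, hC0, hC⟩ := exists_translation_bound hv
  have hc : 0 < √(1 - ρ ^ 2) := Real.sqrt_pos.2 (by nlinarith)
  set c := √(1 - ρ ^ 2) with hcdef
  set κ := ρ / c with hκ
  refine ⟨C * |κ| + C * κ ^ 2, by positivity, fun g hg hgB x => ?_⟩
  have hG : Measurable fun y => g (ρ • x + c • y) := hg.comp (by fun_prop)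
  have key := hC _ hG 1 (fun y => hgB _)
  have hrw : ∀ t : ℝ, OU d ρ g (x + t • v) = ∫ y, g (ρ • x + c • (y + (κ * t) • v)) ∂(gauss d) := by
    intro t
    simp only [OU]
    congr 1
    ext y
    congr 1
    have : ρ • (x + t • v) + c • y = ρ • x + c • y + (ρ * t) • v := by module
    rw [← hcdef, this]
    have : ρ * t = c * (κ * t) := by rw [hκ]; field_simp
    rw [this]
    module
  constructor
  · intro t
    rw [hrw]
    refine ((key (κ * t)).1).trans ?_
    rw [abs_mul]
    nlinarith [mul_nonneg (mul_nonneg hC0 (sq_nonneg κ)) (abs_nonneg t)]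
  · refine ⟨κ * ∫ y, inner ℝ v y * g (ρ • x + c • y) ∂(gauss d), fun t => ?_⟩
    rw [hrw]
    have := (key (κ * t)).2
    rw [mul_comm κ t, mul_assoc] at this
    rw [mul_comm κ t]
    refine this.trans ?_
    nlinarith [mul_nonneg (mul_nonneg hC0 (abs_nonneg κ)) (sq_nonneg t)]

theorem exists_response_translation_bound (h1 : -1 < ρ) (h2 : ρ < 1)
    {v : EuclideanSpace ℝ (Fin d)} (hv : ‖v‖ = 1) (A : Matrix (Fin m) (Fin m) ℝ)
    {g : EuclideanSpace ℝ (Fin d) → Fin m → ℝ} (hg : SimplexMap d m g) :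
    ∃ L, 0 ≤ L ∧ ∀ x i,
      (∀ t : ℝ, |response ρ A g (x + t • v) i - response ρ A g x i| ≤ L * |t|) ∧
        ∃ D : ℝ, ∀ t : ℝ,
          |response ρ A g (x + t • v) i - response ρ A g x i - t * D| ≤ L * t ^ 2 := by
  obtain ⟨L, hL0, hL⟩ := exists_OU_translation_bound h1 h2 hv
  have hi : ∀ i : Fin m, ∑ j, |A i j| * L ≤ ∑ i, ∑ j, |A i j| * L := fun i =>
    Finset.single_le_sum (f := fun i => ∑ j, |A i j| * L)
      (fun i _ => by positivity) (Finset.mem_univ i)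
  refine ⟨∑ i, ∑ j, |A i j| * L, by positivity, fun x i => ?_⟩
  have key := fun j => hL _ (hg.measurable_apply j) (fun x => hg.abs_le x j) x
  choose k1 D k2 using key
  constructor
  · intro t
    simp only [response]
    rw [← Finset.sum_sub_distrib]
    refine (Finset.abs_sum_le_sum_abs _ _).trans ?_
    refine le_trans ?_ (mul_le_mul_of_nonneg_right (hi i) (abs_nonneg t))
    rw [Finset.sum_mul]
    gcongr with j
    rw [← mul_sub, abs_mul, mul_assoc]
    gcongr
    exact k1 j t
  · refine ⟨∑ j, A i j * D j, fun t => ?_⟩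
    simp only [response]
    rw [Finset.mul_sum, ← Finset.sum_sub_distrib, ← Finset.sum_sub_distrib]
    refine (Finset.abs_sum_le_sum_abs _ _).trans ?_
    refine le_trans ?_ (mul_le_mul_of_nonneg_right (hi i) (sq_nonneg t))
    rw [Finset.sum_mul]
    gcongr with j
    rw [mul_left_comm, ← mul_sub, ← mul_sub, abs_mul, mul_assoc]
    gcongr
    exact k2 j t

theorem integral_translation_bound_of_ae {v : EuclideanSpace ℝ (Fin d)} (hv : ‖v‖ = 1) :
    ∃ C, 0 ≤ C ∧ ∀ φ : EuclideanSpace ℝ (Fin d) → ℝ, Measurable φ → ∀ B, 0 ≤ B →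
      (∀ᵐ x ∂(gauss d), |φ x| ≤ B) → ∀ s : ℝ,
        |∫ x, φ (x + s • v) ∂(gauss d) - ∫ x, φ x ∂(gauss d)| ≤ C * B * |s| := by
  obtain ⟨C, hC0, hC⟩ := exists_translation_bound hv
  refine ⟨C, hC0, fun φ hφ B hB0 hB s => ?_⟩
  set ψ : EuclideanSpace ℝ (Fin d) → ℝ := fun x => max (-B) (min B (φ x))
  have hψ : Measurable ψ := measurable_const.max (measurable_const.min hφ)
  have hψB : ∀ x, |ψ x| ≤ B := fun x =>
    abs_le.2 ⟨le_max_left _ _, max_le (by linarith) (min_le_left _ _)⟩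
  have hae : ∀ᵐ x ∂(gauss d), φ x = ψ x := hB.mono fun x hx => by
    have := abs_le.1 hx
    simp only [ψ]
    rw [min_eq_right this.2, max_eq_right this.1]
  rw [integral_congr_ae hae, integral_congr_ae (ae_gauss_add hae (s • v))]
  exact (hC ψ hψ B hψB s).1

end Regularity

/-! ### The penalized distance and its minimizers -/

section Minimizer

variable {d m : ℕ} {ρ δ : ℝ} {P : Matrix (Fin m) (Fin m) ℝ}
  {f g : EuclideanSpace ℝ (Fin d) → Fin m → ℝ}

/-- Squared distance of `Cmat f g` to a target matrix, with a quadratic penalty. -/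
noncomputable def penalizedDist (ρ δ : ℝ) (P : Matrix (Fin m) (Fin m) ℝ)
    (f g : EuclideanSpace ℝ (Fin d) → Fin m → ℝ) : ℝ :=
  ∑ i, ∑ j, (Cmat d m ρ f g i j - P i j) ^ 2 +
    δ * (∫ x, f x ⬝ᵥ f x ∂(gauss d) + ∫ x, g x ⬝ᵥ g x ∂(gauss d))

theorem dotProduct_self_nonneg_real (a : Fin m → ℝ) : 0 ≤ a ⬝ᵥ a :=
  Finset.sum_nonneg fun i _ => mul_self_nonneg (a i)

theorem penalizedDist_nonneg (hδ : 0 ≤ δ) : 0 ≤ penalizedDist ρ δ P f g := by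
  have h1 : 0 ≤ ∫ x, f x ⬝ᵥ f x ∂(gauss d) :=
    integral_nonneg fun x => dotProduct_self_nonneg_real _
  have h2 : 0 ≤ ∫ x, g x ⬝ᵥ g x ∂(gauss d) :=
    integral_nonneg fun x => dotProduct_self_nonneg_real _
  unfold penalizedDist
  positivity

theorem penalizedDist_swap (h1 : -1 ≤ ρ) (h2 : ρ ≤ 1) (hf : SimplexMap d m f)
    (hg : SimplexMap d m g) :
    penalizedDist ρ δ P f g = penalizedDist ρ δ P.transpose g f := by
  unfold penalizedDist
  rw [Finset.sum_comm, add_comm (∫ x, f x ⬝ᵥ f x ∂(gauss d))]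
  simp only [Matrix.transpose_apply, Cmat_transpose h1 h2 hf.bddMeasurable hg.bddMeasurable]

theorem WeakTendsto.tendsto_integral_dotProduct
    {F : ℕ → EuclideanSpace ℝ (Fin d) → Fin m → ℝ} (hF : ∀ n, SimplexMap d m (F n))
    (hf : SimplexMap d m f) (h : WeakTendsto F f) {u : EuclideanSpace ℝ (Fin d) → Fin m → ℝ}
    (hu : BddMeasurable u) :
    Tendsto (fun n => ∫ x, F n x ⬝ᵥ u x ∂(gauss d)) atTop (𝓝 (∫ x, f x ⬝ᵥ u x ∂(gauss d))) := by
  obtain ⟨B, hB⟩ := hu.exists_bound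
  simp only [dotProduct]
  rw [integral_finsetSum _ fun i _ => hf.bddMeasurable.integrable_mul hu i i]
  simp_rw [fun n => integral_finsetSum Finset.univ fun i _ =>
    (hF n).bddMeasurable.integrable_mul hu i i]
  exact tendsto_finsetSum _ fun i _ => h i _
    (integrable_of_abs_le (hu.measurable_apply i) fun x => hB x i)

theorem exists_penalizedDist_minimizer (h1 : -1 < ρ) (h2 : ρ < 1) (hδ : 0 ≤ δ)
    (P : Matrix (Fin m) (Fin m) ℝ) {f₀ g₀ : EuclideanSpace ℝ (Fin d) → Fin m → ℝ}
    (hf₀ : SimplexMap d m f₀) (hg₀ : SimplexMap d m g₀) :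
    ∃ f g, SimplexMap d m f ∧ SimplexMap d m g ∧ ∀ f' g', SimplexMap d m f' → SimplexMap d m g' →
      penalizedDist ρ δ P f g ≤ penalizedDist ρ δ P f' g' := by
  set S : Set ℝ := {q | ∃ f g, SimplexMap d m f ∧ SimplexMap d m g ∧
    q = penalizedDist ρ δ P f g} with hS
  have hSne : S.Nonempty := ⟨_, f₀, g₀, hf₀, hg₀, rfl⟩
  have hSbdd : BddBelow S := ⟨0, by
    rintro q ⟨f, g, -, -, rfl⟩
    exact penalizedDist_nonneg hδ⟩
  obtain ⟨u, -, hu, huS⟩ := exists_seq_tendsto_sInf hSne hSbdd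
  choose F G hF hG hq using huS
  obtain ⟨φ, hφ, f, hf, hFf⟩ := SimplexMap.exists_weakTendsto F hF
  obtain ⟨ψ, hψ, g, hg, hGg⟩ := SimplexMap.exists_weakTendsto (fun n => G (φ n)) fun n => hG _
  replace hFf := hFf.comp hψ
  refine ⟨f, g, hf, hg, fun f' g' hf' hg' => ?_⟩
  refine le_trans ?_ (csInf_le hSbdd ⟨f', g', hf', hg', rfl⟩)
  have hlim := (hu.comp hφ.tendsto_atTop).comp hψ.tendsto_atTop
  have hlow : ∀ {F f : EuclideanSpace ℝ (Fin d) → Fin m → ℝ}, SimplexMap d m F →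
      SimplexMap d m f → 2 * ∫ x, F x ⬝ᵥ f x ∂(gauss d) - ∫ x, f x ⬝ᵥ f x ∂(gauss d) ≤
        ∫ x, F x ⬝ᵥ F x ∂(gauss d) := fun {F f} hF hf => by
    have hFb := hF.bddMeasurable
    have hfb := hf.bddMeasurable
    have h0 : 0 ≤ ∫ x, (F x - f x) ⬝ᵥ (F x - f x) ∂(gauss d) :=
      integral_nonneg fun x => dotProduct_self_nonneg_real _
    rw [integral_sub_dotProduct hFb hfb (hFb.sub hfb), integral_dotProduct_sub hFb hfb hFb,
      integral_dotProduct_sub hFb hfb hfb, integral_dotProduct_comm f F] at h0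
    linarith
  have hC := tendsto_finsetSum Finset.univ fun i (_ : i ∈ Finset.univ) =>
    tendsto_finsetSum Finset.univ fun j (_ : j ∈ Finset.univ) =>
      ((hFf.tendsto_Cmat h1 h2 (fun n => hF _) (fun n => hG _) hg hGg i j).sub_const
        (P i j)).pow 2
  have hEf := ((hFf.tendsto_integral_dotProduct (fun n => hF _) hf hf.bddMeasurable).const_mul
    2).sub_const (∫ x, f x ⬝ᵥ f x ∂(gauss d))
  have hEg := ((hGg.tendsto_integral_dotProduct (fun n => hG _) hg hg.bddMeasurable).const_mul
    2).sub_const (∫ x, g x ⬝ᵥ g x ∂(gauss d))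
  have htot := hC.add ((hEf.add hEg).const_mul δ)
  refine (le_of_eq ?_).trans (le_of_tendsto_of_tendsto' htot hlim fun n => ?_)
  · unfold penalizedDist
    ring
  · simp only [Function.comp_apply, hq]
    unfold penalizedDist
    gcongr
    · exact hlow (hF _) hf
    · exact hlow (hG _) hg

/-- The pointwise optimality condition satisfied by the best reply to a field `h`. -/
def BestReply (δ : ℝ) (f h : EuclideanSpace ℝ (Fin d) → Fin m → ℝ) : Prop :=
  ∀ᵐ x ∂(gauss d), ∀ p ∈ stdSimplex ℝ (Fin m), (p - f x) ⬝ᵥ (h x - (2 * δ) • f x) ≤ 0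

theorem ae_dotProduct_nonpos_of_integral_nonpos (hf : SimplexMap d m f)
    {u : EuclideanSpace ℝ (Fin d) → Fin m → ℝ} (hu : BddMeasurable u)
    (h : ∀ φ, SimplexMap d m φ → ∫ x, (φ x - f x) ⬝ᵥ u x ∂(gauss d) ≤ 0) :
    ∀ᵐ x ∂(gauss d), ∀ p ∈ stdSimplex ℝ (Fin m), (p - f x) ⬝ᵥ u x ≤ 0 := by
  classical
  have hi : ∀ i, ∀ᵐ x ∂(gauss d), u x i ≤ f x ⬝ᵥ u x := by
    intro i
    set S : Set (EuclideanSpace ℝ (Fin d)) := {x | f x ⬝ᵥ u x < u x i}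
    have hS : MeasurableSet S := measurableSet_lt
      (hf.bddMeasurable.measurable_dotProduct hu) (hu.measurable_apply i)
    set φ : EuclideanSpace ℝ (Fin d) → Fin m → ℝ :=
      fun x => if x ∈ S then Pi.single i 1 else f x
    have hφ : SimplexMap d m φ := by
      refine ⟨Measurable.ite hS measurable_const hf.1, fun x => ?_⟩
      simp only [φ]
      split_ifs
      · exact single_mem_stdSimplex ℝ i
      · exact hf.2 x
    have e : ∀ x, (φ x - f x) ⬝ᵥ u x = if x ∈ S then u x i - f x ⬝ᵥ u x else 0 := by
      intro x
      simp only [φ]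
      split_ifs
      · rw [sub_dotProduct, single_dotProduct, one_mul]
      · simp
    have h0 : ∀ x, 0 ≤ (φ x - f x) ⬝ᵥ u x := fun x => by
      rw [e]
      split_ifs with hx
      · exact sub_nonneg.2 (le_of_lt hx)
      · exact le_rfl
    have hz := (integral_eq_zero_iff_of_nonneg h0
      ((hφ.bddMeasurable.sub hf.bddMeasurable).integrable_dotProduct hu)).1
      (le_antisymm (h φ hφ) (integral_nonneg h0))
    filter_upwards [hz] with x hx
    rw [e] at hx
    by_contra hlt
    have hxS : x ∈ S := not_le.1 hlt
    rw [if_pos hxS] at hx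
    simp only [Pi.zero_apply] at hx
    exact hlt (by linarith)
  filter_upwards [ae_all_iff.2 hi] with x hx p hp
  rw [sub_dotProduct, sub_nonpos]
  calc p ⬝ᵥ u x ≤ ∑ i, p i * (f x ⬝ᵥ u x) :=
        Finset.sum_le_sum fun i _ => mul_le_mul_of_nonneg_left (hx i) (hp.1 i)
    _ = f x ⬝ᵥ u x := by rw [← Finset.sum_mul, hp.2, one_mul]

/-- The payoff obtained by linearizing the squared distance. -/
noncomputable def payoff (ρ δ : ℝ) (A : Matrix (Fin m) (Fin m) ℝ)
    (f g : EuclideanSpace ℝ (Fin d) → Fin m → ℝ) : ℝ :=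
  ∫ x, f x ⬝ᵥ response ρ A g x ∂(gauss d) -
    δ * (∫ x, f x ⬝ᵥ f x ∂(gauss d) + ∫ x, g x ⬝ᵥ g x ∂(gauss d))

variable {f' g' : EuclideanSpace ℝ (Fin d) → Fin m → ℝ}

theorem payoff_sub_le (hf : SimplexMap d m f) (hg : SimplexMap d m g)
    (hf' : SimplexMap d m f') (hg' : SimplexMap d m g')
    (h : penalizedDist ρ δ P f g ≤ penalizedDist ρ δ P f' g') :
    payoff ρ δ ((2 : ℝ) • (P - Cmat d m ρ f g)) f' g' -
        payoff ρ δ ((2 : ℝ) • (P - Cmat d m ρ f g)) f g ≤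
      ∑ i, ∑ j, (Cmat d m ρ f' g' i j - Cmat d m ρ f g i j) ^ 2 := by
  unfold payoff
  rw [integral_dotProduct_response hf.bddMeasurable hg.bddMeasurable,
    integral_dotProduct_response hf'.bddMeasurable hg'.bddMeasurable]
  unfold penalizedDist at h
  have e : ∑ i, ∑ j, (Cmat d m ρ f' g' i j - P i j) ^ 2 -
      ∑ i, ∑ j, (Cmat d m ρ f g i j - P i j) ^ 2 =
      ∑ i, ∑ j, (Cmat d m ρ f' g' i j - Cmat d m ρ f g i j) ^ 2 -
      (∑ i, ∑ j, ((2 : ℝ) • (P - Cmat d m ρ f g)) i j * Cmat d m ρ f' g' i j -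
      ∑ i, ∑ j, ((2 : ℝ) • (P - Cmat d m ρ f g)) i j * Cmat d m ρ f g i j) := by
    simp only [← Finset.sum_sub_distrib]
    refine Finset.sum_congr rfl fun i _ => Finset.sum_congr rfl fun j _ => ?_
    simp only [Matrix.smul_apply, Matrix.sub_apply, smul_eq_mul]
    ring
  linarith

theorem Cmat_perturb_sub (hf : SimplexMap d m f) (hg : SimplexMap d m g)
    (hf' : SimplexMap d m f') (ε : ℝ) (i j : Fin m) :
    Cmat d m ρ (fun x => f x + ε • (f' x - f x)) g i j - Cmat d m ρ f g i j =
      ε * Cmat d m ρ (fun x => f' x - f x) g i j := by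
  have hb := hf.bddMeasurable
  have hD := hf'.bddMeasurable.sub hf.bddMeasurable
  simp only [Cmat, Matrix.of_apply]
  rw [← integral_sub ((hb.add (hD.const_smul ε)).integrable_mul
    (hg.bddMeasurable.ou (ρ := ρ)) i j) (hb.integrable_mul (hg.bddMeasurable.ou (ρ := ρ)) i j),
    ← integral_const_mul]
  congr 1
  ext x
  simp only [Pi.add_apply, Pi.smul_apply, Pi.sub_apply, smul_eq_mul]
  ring

theorem BestReply.of_minimizer (hf : SimplexMap d m f) (hg : SimplexMap d m g)
    (hmin : ∀ f', SimplexMap d m f' → penalizedDist ρ δ P f g ≤ penalizedDist ρ δ P f' g) :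
    BestReply δ f (response ρ ((2 : ℝ) • (P - Cmat d m ρ f g)) g) := by
  set A := (2 : ℝ) • (P - Cmat d m ρ f g) with hA
  have hb := hf.bddMeasurable
  have hh : BddMeasurable (response ρ A g) := hg.bddMeasurable.response A
  refine ae_dotProduct_nonpos_of_integral_nonpos hf (hh.sub (hb.const_smul (2 * δ)))
    fun φ hφ => ?_
  have hD := hφ.bddMeasurable.sub hb
  set K := ∑ i, ∑ j, Cmat d m ρ (fun x => φ x - f x) g i j ^ 2 +
    δ * ∫ x, (φ x - f x) ⬝ᵥ (φ x - f x) ∂(gauss d) with hK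
  have key : ∀ ε : ℝ, 0 < ε → ε ≤ 1 →
      ∫ x, (φ x - f x) ⬝ᵥ (response ρ A g x - (2 * δ) • f x) ∂(gauss d) ≤ ε * K := by
    intro ε hε0 hε1
    have hfe : SimplexMap d m fun x => f x + ε • (φ x - f x) :=
      ⟨hf.1.add ((hφ.1.sub hf.1).const_smul ε), fun x =>
        (convex_stdSimplex ℝ (Fin m)).add_smul_sub_mem (hf.2 x) (hφ.2 x) ⟨hε0.le, hε1⟩⟩
    have hp := payoff_sub_le hf hg hfe hg (hmin _ hfe)
    rw [← hA] at hp
    simp only [Cmat_perturb_sub hf hg hφ, mul_pow, ← Finset.mul_sum] at hp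
    have e1 : ∫ x, (f x + ε • (φ x - f x)) ⬝ᵥ response ρ A g x ∂(gauss d) =
        ∫ x, f x ⬝ᵥ response ρ A g x ∂(gauss d) +
          ε * ∫ x, (φ x - f x) ⬝ᵥ response ρ A g x ∂(gauss d) := by
      rw [integral_add_dotProduct hb (hD.const_smul ε) hh, integral_smul_dotProduct]
    have e2 : ∫ x, (f x + ε • (φ x - f x)) ⬝ᵥ (f x + ε • (φ x - f x)) ∂(gauss d) =
        ∫ x, f x ⬝ᵥ f x ∂(gauss d) + (2 * ε) * ∫ x, (φ x - f x) ⬝ᵥ f x ∂(gauss d) +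
          ε ^ 2 * ∫ x, (φ x - f x) ⬝ᵥ (φ x - f x) ∂(gauss d) := by
      have hDe := hD.const_smul ε
      rw [integral_add_dotProduct hb hDe (hb.add hDe), integral_dotProduct_add hb hDe hb,
        integral_dotProduct_add hb hDe hDe, integral_smul_dotProduct, integral_dotProduct_smul,
        integral_smul_dotProduct, integral_dotProduct_smul,
        integral_dotProduct_comm f fun x => φ x - f x]
      ring
    have e3 : ∫ x, (φ x - f x) ⬝ᵥ (response ρ A g x - (2 * δ) • f x) ∂(gauss d) =
        ∫ x, (φ x - f x) ⬝ᵥ response ρ A g x ∂(gauss d) -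
          (2 * δ) * ∫ x, (φ x - f x) ⬝ᵥ f x ∂(gauss d) := by
      rw [integral_dotProduct_sub hh (hb.const_smul (2 * δ)) hD, integral_dotProduct_smul]
    unfold payoff at hp
    rw [e1, e2] at hp
    rw [e3]
    refine le_of_mul_le_mul_left ?_ hε0
    rw [hK]
    linarith
  refine ge_of_tendsto (f := fun ε : ℝ => ε * K) (x := 𝓝[>] 0) ?_ ?_
  · have : Tendsto (fun ε : ℝ => ε * K) (𝓝 0) (𝓝 (0 * K)) :=
      (continuous_id.mul continuous_const).tendsto 0
    rw [zero_mul] at this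
    exact this.mono_left nhdsWithin_le_nhds
  · filter_upwards [Ioc_mem_nhdsGT (zero_lt_one (α := ℝ))] with ε hε
    exact key ε hε.1 hε.2

theorem isSeqClosed_Sset (h1 : -1 < ρ) (h2 : ρ < 1) : IsSeqClosed (Sset ρ m d) := by
  intro M P hM hlim
  choose F G hF hG hq using hM
  obtain ⟨φ, hφ, f, hf, hFf⟩ := SimplexMap.exists_weakTendsto F hF
  obtain ⟨ψ, hψ, g, hg, hGg⟩ := SimplexMap.exists_weakTendsto (fun n => G (φ n)) fun n => hG _
  replace hFf := hFf.comp hψ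
  refine ⟨f, g, hf, hg, ?_⟩
  ext i j
  have hC := hFf.tendsto_Cmat h1 h2 (fun n => hF _) (fun n => hG _) hg hGg i j
  have hP := (((tendsto_pi_nhds.1 (tendsto_pi_nhds.1 hlim i)) j).comp hφ.tendsto_atTop).comp
    hψ.tendsto_atTop
  refine tendsto_nhds_unique hP (hC.congr fun n => ?_)
  simp only [Function.comp_apply, hq]

end Minimizer

/-! ### Second variation along translations -/

section SecondVariation

variable {d m : ℕ} {ρ δ L : ℝ} {v : EuclideanSpace ℝ (Fin d)}
  {f g h : EuclideanSpace ℝ (Fin d) → Fin m → ℝ}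

theorem integral_sub_const_mul_sub {α : Type*} [MeasurableSpace α] {μ : Measure α}
    {a b c : α → ℝ} (ha : Integrable a μ) (hb : Integrable b μ) (hc : Integrable c μ) (δ : ℝ) :
    ∫ x, a x - δ * (b x - c x) ∂μ = ∫ x, a x ∂μ - δ * (∫ x, b x ∂μ - ∫ x, c x ∂μ) := by
  rw [← integral_sub hb hc, ← integral_const_mul]
  exact integral_sub ha ((hb.sub hc).const_mul δ)

theorem dotProduct_le_add_div (hδ : 0 < δ) (D E : Fin m → ℝ) :
    D ⬝ᵥ E ≤ δ * (D ⬝ᵥ D) + (E ⬝ᵥ E) / (4 * δ) := by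
  simp only [dotProduct]
  rw [Finset.mul_sum, Finset.sum_div, ← Finset.sum_add_distrib]
  refine Finset.sum_le_sum fun i _ => ?_
  have : δ * (D i * D i) + E i * E i / (4 * δ) - D i * E i = δ * (D i - E i / (2 * δ)) ^ 2 := by
    field_simp
    ring
  nlinarith [mul_nonneg hδ.le (sq_nonneg (D i - E i / (2 * δ)))]

theorem abs_dotProduct_le {D E : Fin m → ℝ} {a b : ℝ} (hD : ∀ i, |D i| ≤ a)
    (hE : ∀ i, |E i| ≤ b) : |D ⬝ᵥ E| ≤ m * (a * b) := by
  refine (Finset.abs_sum_le_sum_abs _ _).trans ?_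
  calc ∑ i, |D i * E i| ≤ ∑ _i : Fin m, a * b := Finset.sum_le_sum fun i _ => by
        rw [abs_mul]
        exact mul_le_mul (hD i) (hE i) (abs_nonneg _) ((abs_nonneg _).trans (hD i))
    _ = m * (a * b) := by simp

theorem dotProduct_self_le {E : Fin m → ℝ} {b : ℝ} (hE : ∀ i, |E i| ≤ b) :
    E ⬝ᵥ E ≤ m * b ^ 2 := by
  rw [sq]
  exact (le_abs_self _).trans (abs_dotProduct_le hE hE)

theorem BestReply.ae_shift (hf : SimplexMap d m f) (hfh : BestReply δ f h)
    (a b : EuclideanSpace ℝ (Fin d)) :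
    ∀ᵐ x ∂(gauss d),
      2 * δ * ((f (x + a) - f (x + b)) ⬝ᵥ f (x + a)) ≤ (f (x + a) - f (x + b)) ⬝ᵥ h (x + a) := by
  filter_upwards [ae_gauss_add hfh a] with x hx
  have := hx (f (x + b)) (hf.2 _)
  rw [dotProduct_sub, dotProduct_smul, ← neg_sub (f (x + a)), neg_dotProduct,
    neg_dotProduct, smul_eq_mul] at this
  linarith

theorem BestReply.ae_monotone (hf : SimplexMap d m f) (hfh : BestReply δ f h)
    (a b : EuclideanSpace ℝ (Fin d)) :
    ∀ᵐ x ∂(gauss d),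
      2 * δ * ((f (x + a) - f (x + b)) ⬝ᵥ (f (x + a) - f (x + b))) ≤
        (f (x + a) - f (x + b)) ⬝ᵥ (h (x + a) - h (x + b)) := by
  filter_upwards [hfh.ae_shift hf a b, hfh.ae_shift hf b a] with x h1 h2
  rw [← neg_sub (f (x + a)), neg_dotProduct, neg_dotProduct] at h2
  rw [dotProduct_sub, dotProduct_sub _ (h _)]
  linarith

theorem abs_apply_shift_sub_le
    (hL : ∀ x i (t : ℝ), |h (x + t • v) i - h x i| ≤ L * |t|) (a b : ℝ)
    (x : EuclideanSpace ℝ (Fin d)) (i : Fin m) :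
    |(h (x + a • v) - h (x + b • v)) i| ≤ L * |a - b| := by
  have := hL (x + b • v) i (a - b)
  rwa [add_assoc, ← add_smul, add_sub_cancel] at this

theorem BestReply.ae_lipschitz (hδ : 0 < δ) (hf : SimplexMap d m f) (hfh : BestReply δ f h)
    (hL0 : 0 ≤ L) (hL : ∀ x i (t : ℝ), |h (x + t • v) i - h x i| ≤ L * |t|) (a b : ℝ) :
    ∀ᵐ x ∂(gauss d), ∀ i, |(f (x + a • v) - f (x + b • v)) i| ≤ m * L / (2 * δ) * |a - b| := by
  filter_upwards [hfh.ae_monotone hf (a • v) (b • v)] with x hx i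
  set D := f (x + a • v) - f (x + b • v)
  have hE := dotProduct_self_le (abs_apply_shift_sub_le hL a b x)
  set E := h (x + a • v) - h (x + b • v)
  have h1 := dotProduct_le_add_div hδ D E
  have h2 : D i ^ 2 ≤ D ⬝ᵥ D := by
    rw [sq]
    exact Finset.single_le_sum (f := fun i => D i * D i) (fun j _ => mul_self_nonneg _)
      (Finset.mem_univ i)
  refine abs_le_of_sq_le_sq ?_ (by positivity)
  have h3 : δ * (D ⬝ᵥ D) ≤ m * (L * |a - b|) ^ 2 / (4 * δ) := by
    have : (E ⬝ᵥ E) / (4 * δ) ≤ m * (L * |a - b|) ^ 2 / (4 * δ) := by gcongr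
    linarith
  have hm : (m : ℝ) ≤ (m : ℝ) ^ 2 := by
    exact_mod_cast Nat.le_self_pow two_ne_zero m
  calc D i ^ 2 ≤ D ⬝ᵥ D := h2
    _ ≤ m * (L * |a - b|) ^ 2 / (4 * δ) / δ := by
        rw [le_div_iff₀ hδ]
        linarith
    _ ≤ (m : ℝ) ^ 2 * (L * |a - b|) ^ 2 / (4 * δ) / δ := by gcongr
    _ = _ := by
        field_simp
        ring

/-- Change of the payoff against a fixed field when `f` is translated. -/
noncomputable def shiftGain (δ : ℝ) (v : EuclideanSpace ℝ (Fin d))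
    (f h : EuclideanSpace ℝ (Fin d) → Fin m → ℝ) (t : ℝ) : ℝ :=
  ∫ x, (f (x + t • v) - f x) ⬝ᵥ h x ∂(gauss d) -
    δ * (∫ x, f (x + t • v) ⬝ᵥ f (x + t • v) ∂(gauss d) - ∫ x, f x ⬝ᵥ f x ∂(gauss d))

/-- Correlation of the increments of `f` and `h` under a translation. -/
noncomputable def shiftCorr (v : EuclideanSpace ℝ (Fin d))
    (f h : EuclideanSpace ℝ (Fin d) → Fin m → ℝ) (t : ℝ) : ℝ :=
  ∫ x, (f (x + t • v) - f x) ⬝ᵥ (h (x + t • v) - h x) ∂(gauss d)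

theorem BestReply.exists_shiftGain_bound (hv : ‖v‖ = 1) (hδ : 0 < δ) (hf : SimplexMap d m f)
    (hh : BddMeasurable h) (hfh : BestReply δ f h)
    (hL : ∀ x i (t : ℝ), |h (x + t • v) i - h x i| ≤ L * |t|) :
    ∃ K, 0 ≤ K ∧ ∀ t : ℝ,
      |shiftGain δ v f h t + shiftGain δ v f h (-t) + shiftCorr v f h t| ≤ K * |t| ^ 3 := by
  obtain ⟨C, hC0, hC⟩ := integral_translation_bound_of_ae hv
  refine ⟨C * (m * L ^ 2 / (4 * δ)), by positivity, fun t => ?_⟩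
  have hb := hf.bddMeasurable
  have hbt := hb.shift (t • v)
  have hbn := hb.shift (-t • v)
  have hht := hh.shift (t • v)
  set α : EuclideanSpace ℝ (Fin d) → ℝ := fun x =>
    (f (x + t • v) - f x) ⬝ᵥ h (x + t • v) -
      δ * (f (x + t • v) ⬝ᵥ f (x + t • v) - f x ⬝ᵥ f x) with hα
  have hαm : Measurable α := ((hbt.sub hb).measurable_dotProduct hht).sub
    (((hbt.measurable_dotProduct hbt).sub (hb.measurable_dotProduct hb)).const_mul δ)
  have hαB : ∀ᵐ x ∂(gauss d), |α x| ≤ m * (L * |t|) ^ 2 / (4 * δ) := by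
    filter_upwards [hfh.ae_shift hf (t • v) 0, hfh.ae_shift hf 0 (t • v)] with x h1 h2
    simp only [add_zero] at h1 h2
    rw [← neg_sub (f (x + t • v)), neg_dotProduct, neg_dotProduct] at h2
    have hE := dotProduct_self_le (hL x · t)
    change (h (x + t • v) - h x) ⬝ᵥ (h (x + t • v) - h x) ≤ _ at hE
    have h3 := dotProduct_le_add_div hδ (f (x + t • v) - f x) (h (x + t • v) - h x)
    have h4 : (h (x + t • v) - h x) ⬝ᵥ (h (x + t • v) - h x) / (4 * δ) ≤
      m * (L * |t|) ^ 2 / (4 * δ) := by gcongr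
    have h0 := mul_nonneg hδ.le (dotProduct_self_nonneg_real (f (x + t • v) - f x))
    have e1 : f (x + t • v) ⬝ᵥ f (x + t • v) - f x ⬝ᵥ f x =
        (f (x + t • v) - f x) ⬝ᵥ f (x + t • v) + (f (x + t • v) - f x) ⬝ᵥ f x := by
      rw [sub_dotProduct, sub_dotProduct, dotProduct_comm (f x) (f (x + t • v))]
      ring
    have e2 : (f (x + t • v) - f x) ⬝ᵥ (f (x + t • v) - f x) =
        (f (x + t • v) - f x) ⬝ᵥ f (x + t • v) - (f (x + t • v) - f x) ⬝ᵥ f x :=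
      dotProduct_sub _ _ _
    rw [dotProduct_sub _ (h _)] at h3
    simp only [hα]
    rw [e1, abs_le]
    rw [e2] at h0 h3
    constructor <;> linarith
  have key := hC α hαm _ (by positivity) hαB (-t)
  have e1 : ∫ x, α x ∂(gauss d) = shiftGain δ v f h t + shiftCorr v f h t := by
    simp only [hα, shiftGain, shiftCorr]
    rw [integral_sub_const_mul_sub ((hbt.sub hb).integrable_dotProduct hht)
      (hbt.integrable_dotProduct hbt) (hb.integrable_dotProduct hb), integral_dotProduct_sub hht hh (hbt.sub hb)]
    ring
  have e2 : ∫ x, α (x + -t • v) ∂(gauss d) = -shiftGain δ v f h (-t) := by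
    have hx : ∀ x : EuclideanSpace ℝ (Fin d), x + -t • v + t • v = x := fun x => by module
    simp only [hα, shiftGain, hx]
    rw [integral_sub_const_mul_sub ((hb.sub hbn).integrable_dotProduct hh)
      (hb.integrable_dotProduct hb) (hbn.integrable_dotProduct hbn), integral_sub_dotProduct hb hbn hh,
      integral_sub_dotProduct hbn hb hh]
    ring
  rw [e1, e2, abs_neg] at key
  calc _ = |-shiftGain δ v f h (-t) - (shiftGain δ v f h t + shiftCorr v f h t)| := by
        rw [← abs_neg]
        congr 1
        ring
    _ ≤ _ := key
    _ = _ := by ring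

theorem payoff_shift_sub (h1 : -1 ≤ ρ) (h2 : ρ ≤ 1) (hf : SimplexMap d m f)
    (hg : SimplexMap d m g) (A : Matrix (Fin m) (Fin m) ℝ) (t : ℝ) :
    payoff ρ δ A (fun x => f (x + t • v)) (fun x => g (x + (ρ * t) • v)) - payoff ρ δ A f g =
      shiftGain δ v f (response ρ A g) t + shiftCorr v f (response ρ A g) t +
        shiftGain δ v g (response ρ A.transpose f) (ρ * t) := by
  have hfb := hf.bddMeasurable
  have hgb := hg.bddMeasurable
  have hft := hfb.shift (t • v)
  have hgs := hgb.shift ((ρ * t) • v)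
  have hr := hgb.response (ρ := ρ) A
  have hrt := hr.shift (t • v)
  have e : ∀ x, response ρ A (fun y => g (y + (ρ * t) • v)) x = response ρ A g (x + t • v) := by
    intro x
    rw [response_add_right, smul_smul]
  have e2 : ∫ x, (g (x + (ρ * t) • v) - g x) ⬝ᵥ response ρ A.transpose f x ∂(gauss d) =
      ∫ x, f x ⬝ᵥ response ρ A g (x + t • v) ∂(gauss d) -
        ∫ x, f x ⬝ᵥ response ρ A g x ∂(gauss d) := by
    rw [← integral_dotProduct_response_comm h1 h2 hfb (hgs.sub hgb),
      ← integral_dotProduct_sub hrt hr hfb]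
    simp only [response_sub hgs hgb, e]
  simp only [payoff, shiftGain, shiftCorr]
  rw [e2]
  simp only [e]
  rw [integral_dotProduct_sub hrt hr (hft.sub hfb), integral_sub_dotProduct hft hfb hr,
    integral_sub_dotProduct hft hfb hrt]
  ring

theorem shiftCorr_swap (h1 : -1 ≤ ρ) (h2 : ρ ≤ 1) (hf : SimplexMap d m f)
    (hg : SimplexMap d m g) (A : Matrix (Fin m) (Fin m) ℝ) (t : ℝ) :
    shiftCorr v g (response ρ A.transpose f) (ρ * t) =
      ∫ x, (f (x + (ρ ^ 2 * t) • v) - f x) ⬝ᵥ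
        (response ρ A g (x + t • v) - response ρ A g x) ∂(gauss d) := by
  have hfb := hf.bddMeasurable
  have hgb := hg.bddMeasurable
  have hft := hfb.shift ((ρ ^ 2 * t) • v)
  have hgs := hgb.shift ((ρ * t) • v)
  have e : ∀ x, response ρ A g (x + t • v) - response ρ A g x =
      response ρ A (fun y => g (y + (ρ * t) • v) - g y) x := by
    intro x
    rw [response_sub hgs hgb, response_add_right, smul_smul]
  have e2 : ∀ x, response ρ A.transpose f (x + (ρ * t) • v) - response ρ A.transpose f x =
      response ρ A.transpose (fun y => f (y + (ρ ^ 2 * t) • v) - f y) x := by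
    intro x
    rw [response_sub hft hfb, response_add_right, smul_smul, ← mul_assoc, ← sq]
  simp only [shiftCorr, e, e2]
  rw [integral_dotProduct_response_comm h1 h2 (hgs.sub hgb) (hft.sub hfb),
    Matrix.transpose_transpose]

theorem exists_shift_increment_bound (h1 : -1 < ρ) (h2 : ρ < 1) (hv : ‖v‖ = 1) (hδ : 0 < δ)
    (hf : SimplexMap d m f) (hg : SimplexMap d m g) (A : Matrix (Fin m) (Fin m) ℝ)
    (hfr : BestReply δ f (response ρ A g)) (hgr : BestReply δ g (response ρ A.transpose f))
    {K₀ : ℝ} (hJ : ∀ t : ℝ, |t| ≤ 1 →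
      payoff ρ δ A (fun x => f (x + t • v)) (fun x => g (x + (ρ * t) • v)) - payoff ρ δ A f g ≤
        K₀ * |t| ^ 3) :
    ∃ K, 0 ≤ K ∧ ∀ t : ℝ, |t| ≤ 1 →
      ∫ x, (f (x + t • v) - f (x + (ρ ^ 2 * t) • v)) ⬝ᵥ
        (f (x + t • v) - f (x + (ρ ^ 2 * t) • v)) ∂(gauss d) ≤ K * |t| ^ 3 := by
  obtain ⟨L, hL0, hL⟩ := exists_response_translation_bound h1 h2 hv A hg
  obtain ⟨L', -, hL'⟩ := exists_response_translation_bound h1 h2 hv A.transpose hf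
  have hfb := hf.bddMeasurable
  have hr := hg.bddMeasurable.response (ρ := ρ) A
  obtain ⟨Kf, hKf0, hKf⟩ := hfr.exists_shiftGain_bound hv hδ hf hr fun x i => (hL x i).1
  obtain ⟨Kg, hKg0, hKg⟩ := hgr.exists_shiftGain_bound hv hδ hg
    (hf.bddMeasurable.response (ρ := ρ) A.transpose) fun x i => (hL' x i).1
  have hρ2 : ρ ^ 2 ≤ 1 := by nlinarith
  have hρ0 : 0 ≤ 1 - ρ ^ 2 := by linarith
  have hρabs : |ρ| ≤ 1 := abs_le.2 ⟨h1.le, h2.le⟩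
  set h := response ρ A g with hh
  set K₁ : ℝ := (1 - ρ ^ 2) * (2 * |K₀| + Kf + Kg) +
    m * (m * L / (2 * δ) * (1 - ρ ^ 2) * (2 * L)) with hK₁
  have hK₁0 : 0 ≤ K₁ := by positivity
  refine ⟨K₁ / (2 * δ), by positivity, fun t ht => ?_⟩
  have hft := hfb.shift (t • v)
  have hfr' := hfb.shift ((ρ ^ 2 * t) • v)
  have hht := hr.shift (t • v)
  have hhr' := hr.shift ((ρ ^ 2 * t) • v)
  have hD := hft.sub hfr'
  have ht3 : 0 ≤ |t| ^ 3 := by positivity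
  -- comparison of the translation with its opposite
  have hA : ∫ x, (f (x + t • v) - f (x + (ρ ^ 2 * t) • v)) ⬝ᵥ (h (x + t • v) - h x) ∂(gauss d) ≤
      (2 * |K₀| + Kf + Kg) * |t| ^ 3 := by
    have k1 := hJ t ht
    have k2 := hJ (-t) (by rwa [abs_neg])
    rw [payoff_shift_sub h1.le h2.le hf hg] at k1 k2
    have k3 := (abs_le.1 (hKf (-t))).1
    have k4 := (abs_le.1 (hKg (ρ * t))).1
    rw [shiftCorr_swap h1.le h2.le hf hg] at k4
    have k5 : |ρ * t| ^ 3 ≤ |t| ^ 3 := by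
      rw [abs_mul]
      exact pow_le_pow_left₀ (by positivity) (mul_le_of_le_one_left (abs_nonneg t) hρabs) 3
    have k6 : K₀ * |t| ^ 3 ≤ |K₀| * |t| ^ 3 := by gcongr; exact le_abs_self _
    have k7 : Kg * |ρ * t| ^ 3 ≤ Kg * |t| ^ 3 := by gcongr
    have k8 : ∫ x, (f (x + t • v) - f (x + (ρ ^ 2 * t) • v)) ⬝ᵥ (h (x + t • v) - h x)
        ∂(gauss d) = shiftCorr v f h t -
        ∫ x, (f (x + (ρ ^ 2 * t) • v) - f x) ⬝ᵥ (h (x + t • v) - h x) ∂(gauss d) := by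
      rw [shiftCorr, ← integral_sub_dotProduct (hft.sub hfb) (hfr'.sub hfb) (hht.sub hr)]
      simp only [sub_sub_sub_cancel_right]
    rw [abs_neg, neg_neg] at k3
    rw [abs_neg, mul_neg] at k2
    rw [k8]
    linarith
  -- replacing the increment of `h` by a shorter one
  have hB : |∫ x, (f (x + t • v) - f (x + (ρ ^ 2 * t) • v)) ⬝ᵥ
      ((h (x + t • v) - h (x + (ρ ^ 2 * t) • v)) - (1 - ρ ^ 2) • (h (x + t • v) - h x))
        ∂(gauss d)| ≤ m * (m * L / (2 * δ) * (1 - ρ ^ 2) * (2 * L)) * |t| ^ 3 := by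
    refine abs_integral_le_of_abs_le ?_
    filter_upwards [hfr.ae_lipschitz hδ hf hL0 (fun x i => (hL x i).1) t (ρ ^ 2 * t)] with x hx
    have e : |t - ρ ^ 2 * t| = (1 - ρ ^ 2) * |t| := by
      rw [← one_sub_mul, abs_mul, abs_of_nonneg hρ0]
    rw [e] at hx
    refine (abs_dotProduct_le hx (b := 2 * L * t ^ 2) fun i => ?_).trans_eq ?_
    · obtain ⟨D, hD⟩ := (hL x i).2
      have q1 := abs_le.1 (hD t)
      have q2 := abs_le.1 (hD (ρ ^ 2 * t))
      simp only [Pi.sub_apply, Pi.smul_apply, smul_eq_mul]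
      have q3 : (ρ ^ 2 * t) ^ 2 ≤ t ^ 2 := by
        rw [mul_pow]
        exact mul_le_of_le_one_left (sq_nonneg t) (pow_le_one₀ (sq_nonneg ρ) hρ2)
      have q4 : L * (ρ ^ 2 * t) ^ 2 ≤ L * t ^ 2 := by gcongr
      have q5 := mul_le_mul_of_nonneg_left q1.1 (sq_nonneg ρ)
      have q6 := mul_le_mul_of_nonneg_left q1.2 (sq_nonneg ρ)
      have q7 : ρ ^ 2 * (L * t ^ 2) ≤ L * t ^ 2 := mul_le_of_le_one_left (by positivity) hρ2
      rw [abs_le]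
      constructor <;> linarith
    · rw [← sq_abs t]
      ring
  rw [integral_dotProduct_sub (hht.sub hhr') ((hht.sub hr).const_smul _) hD,
    integral_dotProduct_smul] at hB
  have hM : 2 * δ * ∫ x, (f (x + t • v) - f (x + (ρ ^ 2 * t) • v)) ⬝ᵥ
        (f (x + t • v) - f (x + (ρ ^ 2 * t) • v)) ∂(gauss d) ≤
      ∫ x, (f (x + t • v) - f (x + (ρ ^ 2 * t) • v)) ⬝ᵥ
        (h (x + t • v) - h (x + (ρ ^ 2 * t) • v)) ∂(gauss d) := by
    rw [← integral_const_mul]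
    exact integral_mono_ae ((hD.integrable_dotProduct hD).const_mul _)
      (hD.integrable_dotProduct (hht.sub hhr')) (hfr.ae_monotone hf _ _)
  have hA' := mul_le_mul_of_nonneg_left hA hρ0
  have hB' := (abs_le.1 hB).2
  rw [div_mul_eq_mul_div, le_div_iff₀ (by positivity), hK₁]
  linarith

end SecondVariation

/-! ### Invariance of minimizers in some direction -/

section Invariance

variable {d m : ℕ} {ρ δ : ℝ} {v : EuclideanSpace ℝ (Fin d)}
  {f g : EuclideanSpace ℝ (Fin d) → Fin m → ℝ} {P : Matrix (Fin m) (Fin m) ℝ}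

theorem integral_abs_shift_sub_le_sum {φ : EuclideanSpace ℝ (Fin d) → ℝ} (hφ : Measurable φ)
    (hB : ∀ x, |φ x| ≤ 1) (u : ℝ) (N : ℕ) :
    ∫ x, |φ (x + (N * u) • v) - φ x| ∂(gauss d) ≤
      ∑ k ∈ Finset.range N,
        ∫ x, |φ (x + ((k + 1) * u) • v) - φ (x + (k * u) • v)| ∂(gauss d) := by
  have hi : ∀ a b : ℝ, Integrable (fun x => |φ (x + a • v) - φ (x + b • v)|) (gauss d) :=
    fun a b => integrable_of_abs_le (B := 2)
      ((hφ.comp (measurable_add_const _)).sub (hφ.comp (measurable_add_const _))).abs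
      fun x => by
        rw [abs_abs]
        exact (abs_sub _ _).trans (by linarith [hB (x + a • v), hB (x + b • v)])
  rw [← integral_finsetSum _ fun k _ => hi _ _]
  refine integral_mono (by simpa using hi (N * u) 0) (integrable_finsetSum _ fun k _ => hi _ _)
    fun x => ?_
  have := Finset.sum_range_sub (fun k : ℕ => φ (x + (k * u) • v)) N
  simp only [Nat.cast_zero, zero_mul, zero_smul, add_zero, Nat.cast_add, Nat.cast_one] at this
  dsimp only
  rw [← this]
  exact Finset.abs_sum_le_sum_abs _ _

theorem ae_shift_eq_of_increment_bound (hv : ‖v‖ = 1) (hf : SimplexMap d m f) {r K : ℝ}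
    (hr0 : 0 ≤ r) (hr : r < 1)
    (h : ∀ t : ℝ, |t| ≤ 1 → ∫ x, (f (x + t • v) - f (x + (r * t) • v)) ⬝ᵥ
        (f (x + t • v) - f (x + (r * t) • v)) ∂(gauss d) ≤ K * |t| ^ 3) (T : ℝ) :
    ∀ᵐ x ∂(gauss d), f (x + T • v) = f x := by
  have hr' : 0 < 1 - r := by linarith
  suffices hi : ∀ i, ∀ᵐ x ∂(gauss d), f (x + T • v) i = f x i by
    filter_upwards [ae_all_iff.2 hi] with x hx
    exact funext hx
  intro i
  have hfm := hf.measurable_apply i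
  set c : ℝ := |T| / (1 - r) with hc
  have hc0 : 0 ≤ c := by positivity
  set M : ℝ := Real.exp ((|T| + 1) ^ 2)
  have key : ∀ n : ℕ, 0 < n → c ≤ n →
      ∫ x, |f (x + T • v) i - f x i| ∂(gauss d) ≤ (K * c ^ 3 + M) / n := by
    intro n hn hcn
    have hn' : (0 : ℝ) < n := by exact_mod_cast hn
    have hn1 : (1 : ℝ) ≤ n := by exact_mod_cast hn
    set u : ℝ := T / (n : ℝ) ^ 2 with hu
    set t : ℝ := u / (1 - r) with ht
    have hut : u = (1 - r) * t := by rw [ht]; field_simp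
    have htabs : |t| = c / (n : ℝ) ^ 2 := by
      rw [ht, hu, hc, abs_div, abs_div, abs_of_pos hr', abs_of_pos (by positivity : 0 < (n : ℝ) ^ 2)]
      field_simp
    have ht1 : |t| ≤ 1 := by
      rw [htabs, div_le_one (by positivity)]
      nlinarith
    set φ : EuclideanSpace ℝ (Fin d) → ℝ :=
      fun x => |f (x + t • v) i - f (x + (r * t) • v) i| with hφ
    have hφm : Measurable φ := ((hfm.comp (measurable_add_const _)).sub
      (hfm.comp (measurable_add_const _))).abs
    have hφB : ∀ x, |φ x| ≤ 2 := fun x => by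
      rw [hφ, abs_abs]
      have h1 := hf.abs_le (x + t • v) i
      have h2 := hf.abs_le (x + (r * t) • v) i
      exact (abs_sub _ _).trans (by linarith)
    have hD := (hf.bddMeasurable.shift (t • v)).sub (hf.bddMeasurable.shift ((r * t) • v))
    have hφ2 : ∫ x, φ x ^ 2 ∂(gauss d) ≤ K * |t| ^ 3 := by
      refine le_trans (integral_mono (integrable_of_abs_le (hφm.pow_const 2) (B := 2 ^ 2)
        fun x => ?_) (hD.integrable_dotProduct hD) fun x => ?_) (h t ht1)
      · rw [abs_pow]
        gcongr
        exact hφB x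
      · simp only [hφ, sq_abs]
        rw [sq]
        exact Finset.single_le_sum (f := fun j => (f (x + t • v) - f (x + (r * t) • v)) j *
          (f (x + t • v) - f (x + (r * t) • v)) j) (fun j _ => mul_self_nonneg _)
          (Finset.mem_univ i)
    have hterm : ∀ k ∈ Finset.range (n ^ 2),
        ∫ x, |f (x + ((k + 1) * u) • v) i - f (x + (k * u) • v) i| ∂(gauss d) ≤
          K * |t| ^ 3 / (1 / (n : ℝ) ^ 3) + 1 / (n : ℝ) ^ 3 * M := by
      intro k hk
      have hkn : (k : ℝ) ≤ (n : ℝ) ^ 2 := by exact_mod_cast (Finset.mem_range.1 hk).le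
      have hε : (0 : ℝ) < 1 / (n : ℝ) ^ 3 := by positivity
      have hs := integral_shift_le hv hφm hφB hε (k * u - r * t)
      have e1 : ∀ x, x + (k * u - r * t) • v + t • v = x + ((k + 1) * u) • v := fun x => by
        rw [add_assoc, ← add_smul]
        congr 2
        linear_combination -hut
      have e2 : ∀ x, x + (k * u - r * t) • v + (r * t) • v = x + (k * u) • v := fun x => by
        rw [add_assoc, ← add_smul, sub_add_cancel]
      simp only [hφ, e1, e2] at hs
      refine hs.trans ?_
      have ha : |k * u - r * t| ≤ |T| + 1 := by
        refine (abs_sub _ _).trans (add_le_add ?_ ?_)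
        · rw [abs_mul, Nat.abs_cast, hu, abs_div, abs_of_pos (by positivity : 0 < (n : ℝ) ^ 2),
            ← mul_div_assoc, div_le_iff₀ (by positivity), mul_comm]
          gcongr
        · rw [abs_mul, abs_of_nonneg hr0]
          exact mul_le_one₀ hr.le (abs_nonneg t) ht1
      have hM : Real.exp ((k * u - r * t) ^ 2) ≤ M := by
        refine Real.exp_le_exp.2 ?_
        rw [← sq_abs]
        gcongr
      gcongr
    have hsum := (integral_abs_shift_sub_le_sum (v := v) hfm (fun x => hf.abs_le x i) u
      (n ^ 2)).trans (Finset.sum_le_sum hterm)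
    have hT : ((n ^ 2 : ℕ) : ℝ) * u = T := by
      rw [hu]
      push_cast
      field_simp
    rw [hT, Finset.sum_const, Finset.card_range, nsmul_eq_mul, htabs] at hsum
    refine hsum.trans_eq ?_
    push_cast
    field_simp
  have hlim : Tendsto (fun n : ℕ => (K * c ^ 3 + M) / (n : ℝ)) atTop (𝓝 0) :=
    tendsto_const_div_atTop_nhds_zero_nat _
  have hle : ∫ x, |f (x + T • v) i - f x i| ∂(gauss d) ≤ 0 := by
    refine ge_of_tendsto hlim ?_
    filter_upwards [eventually_gt_atTop 0, eventually_ge_atTop ⌈c⌉₊] with n hn hn2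
    exact key n hn ((Nat.le_ceil c).trans (by exact_mod_cast hn2))
  have hInt : Integrable (fun x => |f (x + T • v) i - f x i|) (gauss d) :=
    integrable_of_abs_le (B := 2) ((hfm.comp (measurable_add_const _)).sub hfm).abs fun x => by
      rw [abs_abs]
      exact (abs_sub _ _).trans (by linarith [hf.abs_le (x + T • v) i, hf.abs_le x i])
  have hz := (integral_eq_zero_iff_of_nonneg (fun x => abs_nonneg _) hInt).1
    (le_antisymm hle (integral_nonneg fun x => abs_nonneg _))
  filter_upwards [hz] with x hx
  exact sub_eq_zero.1 (abs_eq_zero.1 hx)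

theorem exists_unit_orthogonal_moments (hm : 0 < m) (hd : m ^ 2 ≤ d) (hf : SimplexMap d m f)
    (hg : SimplexMap d m g) :
    ∃ v : EuclideanSpace ℝ (Fin d), ‖v‖ = 1 ∧
      ∀ i j, ∫ x, inner ℝ v x * (f x i * g x j) ∂(gauss d) = 0 := by
  have hfg : ∀ i j, Measurable fun x => f x i * g x j := fun i j =>
    (hf.measurable_apply i).mul (hg.measurable_apply j)
  have hfgB : ∀ i j x, |f x i * g x j| ≤ 1 := fun i j x => by
    rw [abs_mul]
    exact mul_le_one₀ (hf.abs_le x i) (abs_nonneg _) (hg.abs_le x j)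
  have hInt := fun w i j => integrable_inner_mul w (hfg i j) (hfgB i j)
  let p₀ : Fin m × Fin m := (⟨0, hm⟩, ⟨0, hm⟩)
  let Λ : EuclideanSpace ℝ (Fin d) →ₗ[ℝ] ({p : Fin m × Fin m // p ≠ p₀} → ℝ) :=
    { toFun := fun w p => ∫ x, inner ℝ w x * (f x p.1.1 * g x p.1.2) ∂(gauss d)
      map_add' := fun w w' => by
        ext p
        simp only [inner_add_left, add_mul, Pi.add_apply]
        exact integral_add (hInt _ _ _) (hInt _ _ _)
      map_smul' := fun c w => by
        ext p
        simp only [inner_smul_left, mul_assoc, Pi.smul_apply, smul_eq_mul, RingHom.id_apply]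
        exact integral_const_mul _ _ }
  have hker : LinearMap.ker Λ ≠ ⊥ := by
    refine Λ.ker_ne_bot_of_finrank_lt ?_
    rw [Module.finrank_fintype_fun_eq_card, finrank_euclideanSpace_fin,
      Fintype.card_subtype_compl, Fintype.card_prod, Fintype.card_fin, Fintype.card_subtype_eq]
    have : 0 < m ^ 2 := by positivity
    rw [← sq]
    lia
  obtain ⟨w, hw, hw0⟩ := Submodule.exists_mem_ne_zero_of_ne_bot hker
  have hwp : ∀ p : Fin m × Fin m, p ≠ p₀ →
      ∫ x, inner ℝ w x * (f x p.1 * g x p.2) ∂(gauss d) = 0 := fun p hp =>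
    congr_fun (LinearMap.mem_ker.1 hw) ⟨p, hp⟩
  have hmean : ∫ x, inner ℝ w x ∂(gauss d) = 0 := by
    rw [gauss_eq_stdGaussian]
    exact integral_strongDual_stdGaussian (innerSL ℝ w)
  have hall : ∀ p : Fin m × Fin m,
      ∫ x, inner ℝ w x * (f x p.1 * g x p.2) ∂(gauss d) = 0 := by
    intro p
    by_cases hp : p = p₀
    · have hsum : ∑ p : Fin m × Fin m,
          ∫ x, inner ℝ w x * (f x p.1 * g x p.2) ∂(gauss d) = 0 := by
        rw [← integral_finsetSum _ fun p _ => hInt _ _ _]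
        refine Eq.trans ?_ hmean
        congr 1
        ext x
        rw [← Finset.mul_sum, Fintype.sum_prod_type]
        simp only [← Finset.mul_sum, hg.sum_eq, mul_one, hf.sum_eq]
      rw [Finset.sum_eq_single p₀ (fun p _ hp => hwp p hp) (by simp)] at hsum
      rw [hp]
      exact hsum
    · exact hwp p hp
  refine ⟨‖w‖⁻¹ • w, norm_smul_inv_norm hw0, fun i j => ?_⟩
  simp only [inner_smul_left, mul_assoc, integral_const_mul, hall (i, j), mul_zero]

theorem exists_invariant_direction_of_minimizer (h1 : -1 < ρ) (h2 : ρ < 1) (hδ : 0 < δ)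
    (hm : 0 < m) (hd : m ^ 2 ≤ d) (hf : SimplexMap d m f) (hg : SimplexMap d m g)
    (hmin : ∀ f' g', SimplexMap d m f' → SimplexMap d m g' →
      penalizedDist ρ δ P f g ≤ penalizedDist ρ δ P f' g') :
    ∃ v : EuclideanSpace ℝ (Fin d), ‖v‖ = 1 ∧
      ∀ T : ℝ, ∀ᵐ x ∂(gauss d), f (x + T • v) = f x := by
  obtain ⟨v, hv, hmom⟩ := exists_unit_orthogonal_moments hm hd hf (hg.ou (ρ := ρ))
  obtain ⟨C, hC0, hC⟩ := exists_translation_bound hv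
  have hCt : ∀ (t : ℝ) (i j : Fin m),
      |Cmat d m ρ (fun x => f (x + t • v)) (fun x => g (x + (ρ * t) • v)) i j -
        Cmat d m ρ f g i j| ≤ C * t ^ 2 := by
    intro t i j
    have := (hC (fun x => f x i * OU d ρ (fun y => g y j) x)
      ((hf.measurable_apply i).mul (measurable_OU (hg.measurable_apply j))) 1
      (fun x => by
        rw [abs_mul]
        exact mul_le_one₀ (hf.abs_le x i) (abs_nonneg _) (abs_OU_le (fun y => hg.abs_le y j) x))
      t).2
    rw [hmom, mul_zero, sub_zero, mul_one] at this
    simp only [OU_add, smul_smul] at this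
    exact this
  set A := (2 : ℝ) • (P - Cmat d m ρ f g) with hA
  have hfr : BestReply δ f (response ρ A g) :=
    BestReply.of_minimizer hf hg fun f' hf' => hmin f' g hf' hg
  have hgr : BestReply δ g (response ρ A.transpose f) := by
    have := BestReply.of_minimizer (ρ := ρ) (δ := δ) (P := P.transpose) hg hf fun g' hg' => by
      rw [← penalizedDist_swap h1.le h2.le hf hg, ← penalizedDist_swap h1.le h2.le hf hg']
      exact hmin f g' hf hg'
    convert this using 2
    ext i j
    simp only [hA, Matrix.transpose_apply, Matrix.smul_apply, Matrix.sub_apply,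
      Cmat_transpose h1.le h2.le hf.bddMeasurable hg.bddMeasurable]
  obtain ⟨K, -, hK⟩ := exists_shift_increment_bound h1 h2 hv hδ hf hg A hfr hgr
    (K₀ := (m : ℝ) * (m * C ^ 2)) fun t ht => by
      refine (payoff_sub_le hf hg (hf.shift _) (hg.shift _)
        (hmin _ _ (hf.shift _) (hg.shift _))).trans ?_
      calc _ ≤ ∑ _i : Fin m, ∑ _j : Fin m, C ^ 2 * |t| ^ 3 := by
            gcongr with i _ j _
            rw [← sq_abs]
            calc _ ≤ (C * t ^ 2) ^ 2 := by
                  gcongr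
                  exact hCt t i j
              _ = C ^ 2 * |t| ^ 4 := by rw [mul_pow, ← sq_abs t]; ring
              _ ≤ _ := by
                  gcongr C ^ 2 * ?_
                  exact pow_le_pow_of_le_one (abs_nonneg t) ht (by norm_num)
        _ = _ := by simp; ring
  exact ⟨v, hv, ae_shift_eq_of_increment_bound hv hf (sq_nonneg ρ) (by nlinarith) hK⟩

end Invariance

/-! ### Removing an invariant direction -/

section Reduction

variable {d m : ℕ} {ρ : ℝ}

/-- A splitting of `ℝ^(d+1)` into the line spanned by `v` and an isometric copy of `ℝ^d`. -/
structure Splitting (d : ℕ) (v : EuclideanSpace ℝ (Fin (d + 1))) where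
  /-- The isometric embedding of `ℝ^d` onto the orthogonal complement of `v`. -/
  incl : EuclideanSpace ℝ (Fin d) →L[ℝ] EuclideanSpace ℝ (Fin (d + 1))
  /-- The adjoint of `incl`. -/
  proj : EuclideanSpace ℝ (Fin (d + 1)) →L[ℝ] EuclideanSpace ℝ (Fin d)
  inner_incl : ∀ z s, inner ℝ (incl z) s = inner ℝ z (proj s)
  proj_incl : ∀ z, proj (incl z) = z
  proj_axis : proj v = 0
  norm_sq : ∀ s, ‖s‖ ^ 2 = inner ℝ v s ^ 2 + ‖proj s‖ ^ 2

theorem exists_splitting {v : EuclideanSpace ℝ (Fin (d + 1))} (hv : ‖v‖ = 1) :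
    Nonempty (Splitting d v) := by
  have : Fact (Module.finrank ℝ (EuclideanSpace ℝ (Fin (d + 1))) = d + 1) := ⟨by simp⟩
  have hv0 : v ≠ 0 := by
    rintro rfl
    simp at hv
  let b := OrthonormalBasis.fromOrthogonalSpanSingleton (𝕜 := ℝ) d hv0
  let L : EuclideanSpace ℝ (Fin d) →ₗᵢ[ℝ] EuclideanSpace ℝ (Fin (d + 1)) :=
    (Submodule.subtypeₗᵢ _).comp b.repr.symm.toLinearIsometry
  have hvL : ∀ z, inner ℝ v (L z) = 0 := fun z =>
    Submodule.mem_orthogonal_singleton_iff_inner_right.1 (b.repr.symm z).2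
  have hadj : ∀ z s, inner ℝ (L z) s = inner ℝ z (L.toContinuousLinearMap.adjoint s) :=
    fun z s => (ContinuousLinearMap.adjoint_inner_right L.toContinuousLinearMap z s).symm
  have hpl : ∀ z, L.toContinuousLinearMap.adjoint (L z) = z := fun z =>
    ext_inner_left ℝ fun w => by rw [← hadj, L.inner_map_map]
  have hpv : L.toContinuousLinearMap.adjoint v = 0 :=
    ext_inner_left ℝ fun w => by rw [← hadj, real_inner_comm, hvL, inner_zero_right]
  refine ⟨L.toContinuousLinearMap, L.toContinuousLinearMap.adjoint, hadj, hpl, hpv, fun s => ?_⟩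
  have hmem : s - inner ℝ v s • v ∈ (Submodule.span ℝ {v})ᗮ := by
    rw [Submodule.mem_orthogonal_singleton_iff_inner_right, inner_sub_right, inner_smul_right,
      real_inner_self_eq_norm_sq, hv]
    ring
  have hz : s = inner ℝ v s • v + L (b.repr ⟨_, hmem⟩) := by
    simp [L]
  have hp : L.toContinuousLinearMap.adjoint s = b.repr ⟨_, hmem⟩ := by
    conv_lhs => rw [hz]
    rw [map_add, map_smul, hpv, hpl, smul_zero, zero_add]
  rw [hp]
  conv_lhs => rw [hz]
  rw [@norm_add_sq_real, inner_smul_left, hvL, norm_smul, hv, L.norm_map]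
  simp

namespace Splitting

variable {v : EuclideanSpace ℝ (Fin (d + 1))} (S : Splitting d v)

/-- The coordinates `(t, z) ↦ t v + incl z`. -/
def coord (p : ℝ × EuclideanSpace ℝ (Fin d)) : EuclideanSpace ℝ (Fin (d + 1)) :=
  p.1 • v + S.incl p.2

theorem measurable_coord : Measurable S.coord := by
  unfold coord
  fun_prop

theorem proj_coord (p : ℝ × EuclideanSpace ℝ (Fin d)) : S.proj (S.coord p) = p.2 := by
  rw [coord, map_add, map_smul, S.proj_axis, S.proj_incl, smul_zero, zero_add]

theorem map_coord : ((gaussianReal 0 1).prod (gauss d)).map S.coord = gauss (d + 1) := by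
  have : IsProbabilityMeasure (((gaussianReal 0 1).prod (gauss d)).map S.coord) :=
    Measure.isProbabilityMeasure_map S.measurable_coord.aemeasurable
  refine Measure.ext_of_charFun ?_
  ext s
  have hd := charFun_stdGaussian (E := EuclideanSpace ℝ (Fin d)) (S.proj s)
  have h1 := charFun_gaussianReal (μ := 0) (v := 1) (inner ℝ v s)
  rw [← gauss_eq_stdGaussian, charFun_apply] at hd
  rw [charFun_apply] at h1
  rw [gauss_eq_stdGaussian (d + 1), charFun_stdGaussian, charFun_apply,
    integral_map S.measurable_coord.aemeasurable (by fun_prop)]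
  have h : ∀ p : ℝ × EuclideanSpace ℝ (Fin d),
      Complex.exp (inner ℝ (S.coord p) s * Complex.I) =
        Complex.exp (inner ℝ p.1 (inner ℝ v s) * Complex.I) *
          Complex.exp (inner ℝ p.2 (S.proj s) * Complex.I) := fun p => by
    rw [← Complex.exp_add, coord, inner_add_left, S.inner_incl, inner_smul_left]
    simp
    ring_nf
  simp_rw [h]
  rw [integral_prod_mul (fun t : ℝ => Complex.exp (inner ℝ t (inner ℝ v s) * Complex.I))
    (fun z => Complex.exp (inner ℝ z (S.proj s) * Complex.I)), hd, h1, ← Complex.exp_add]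
  have hn : ((‖s‖ : ℂ)) ^ 2 = (inner ℝ v s : ℝ) ^ 2 + (‖S.proj s‖ : ℂ) ^ 2 := by
    exact_mod_cast S.norm_sq s
  rw [hn]
  congr 1
  simp
  ring

theorem map_proj : (gauss (d + 1)).map S.proj = gauss d := by
  rw [← S.map_coord, Measure.map_map (by fun_prop) S.measurable_coord]
  have : (S.proj ∘ S.coord) = Prod.snd := funext S.proj_coord
  rw [this, Measure.map_snd_prod]
  simp

theorem OU_comp_proj {h : EuclideanSpace ℝ (Fin d) → ℝ} (hh : Measurable h)
    (x : EuclideanSpace ℝ (Fin (d + 1))) :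
    OU (d + 1) ρ (fun y => h (S.proj y)) x = OU d ρ h (S.proj x) := by
  have hm : Measurable fun y => h (ρ • S.proj x + √(1 - ρ ^ 2) • y) := hh.comp (by fun_prop)
  rw [OU, OU, ← S.map_proj, integral_map (by fun_prop) hm.aestronglyMeasurable]
  simp

theorem Cmat_comp_proj {f g : EuclideanSpace ℝ (Fin d) → (Fin m → ℝ)} (hf : SimplexMap d m f)
    (hg : SimplexMap d m g) :
    Cmat (d + 1) m ρ (fun x => f (S.proj x)) (fun x => g (S.proj x)) = Cmat d m ρ f g := by
  ext i j
  simp only [Cmat, Matrix.of_apply]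
  simp_rw [S.OU_comp_proj (hg.measurable_apply j)]
  have hm : Measurable fun z => f z i * OU d ρ (fun y => g y j) z :=
    (hf.measurable_apply i).mul (measurable_OU (hg.measurable_apply j))
  rw [← S.map_proj, integral_map (by fun_prop) hm.aestronglyMeasurable]

/-- A map invariant under all translations along `v` factors through `proj`. -/
theorem exists_ae_eq_comp_proj {f : EuclideanSpace ℝ (Fin (d + 1)) → (Fin m → ℝ)}
    (hf : SimplexMap (d + 1) m f)
    (hinv : ∀ T : ℝ, ∀ᵐ x ∂(gauss (d + 1)), f (x + T • v) = f x) :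
    ∃ F, SimplexMap d m F ∧ ∀ᵐ x ∂(gauss (d + 1)), f x = F (S.proj x) := by
  have hc := S.measurable_coord
  have hinv2 : ∀ T : ℝ, ∀ᵐ p ∂((gaussianReal 0 1).prod (gauss d)),
      f (S.coord (p.1 + T, p.2)) = f (S.coord p) := fun T => by
    have h := hinv T
    rw [← S.map_coord] at h
    filter_upwards [ae_of_ae_map hc.aemeasurable h] with p hp
    rw [← hp]
    congr 1
    simp only [coord]
    module
  have hmeas : MeasurableSet {q : ℝ × ℝ × EuclideanSpace ℝ (Fin d) |
      f (S.coord (q.2.1 + q.1, q.2.2)) = f (S.coord q.2)} :=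
    measurableSet_eq_fun (hf.1.comp (hc.comp (by fun_prop)))
      (hf.1.comp (hc.comp (by fun_prop)))
  have h3 : ∀ᵐ q ∂((volume : Measure ℝ).prod ((gaussianReal 0 1).prod (gauss d))),
      f (S.coord (q.2.1 + q.1, q.2.2)) = f (S.coord q.2) :=
    (Measure.ae_prod_mem_iff_ae_ae_mem hmeas).2 (ae_of_all _ hinv2)
  have h4 : ∀ᵐ T, ∀ᵐ t ∂(gaussianReal 0 1), ∀ᵐ z ∂(gauss d),
      f (S.coord (t + T, z)) = f (S.coord (t, z)) := by
    filter_upwards [Measure.ae_ae_of_ae_prod h3] with T hT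
    exact Measure.ae_ae_of_ae_prod hT
  have hmeas2 : MeasurableSet {q : ℝ × ℝ | ∀ᵐ z ∂(gauss d),
      f (S.coord (q.2 + q.1, z)) = f (S.coord (q.2, z))} := by
    have hq : Measurable fun q : (ℝ × ℝ) × EuclideanSpace ℝ (Fin d) => (q.1.1, q.1.2, q.2) := by
      fun_prop
    exact measurable_measure_prodMk_left (ν := gauss d) (hq hmeas).compl (measurableSet_singleton 0)
  have h5 := (Measure.ae_ae_comm hmeas2).1 h4
  obtain ⟨s, hs⟩ := h5.exists
  refine ⟨fun z => f (S.coord (s, z)), hf.comp (hc.comp (by fun_prop)), ?_⟩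
  have h6 : ∀ᵐ t : ℝ, ∀ᵐ z ∂(gauss d), f (S.coord (t, z)) = f (S.coord (s, z)) := by
    have := (quasiMeasurePreserving_add_left (volume : Measure ℝ) (-s)).ae hs
    filter_upwards [this] with t ht
    simpa using ht
  have h7 : ∀ᵐ p ∂((gaussianReal 0 1).prod (gauss d)),
      f (S.coord p) = f (S.coord (s, p.2)) :=
    (Measure.ae_prod_mem_iff_ae_ae_mem (s := {p | f (S.coord p) = f (S.coord (s, p.2))})
      (measurableSet_eq_fun (hf.1.comp hc) (hf.1.comp (hc.comp (by fun_prop))))).2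
      ((gaussianReal_absolutelyContinuous 0 one_ne_zero).ae_le h6)
  have hm : Measurable fun x => f (S.coord (s, S.proj x)) := hf.1.comp (hc.comp (by fun_prop))
  rw [← S.map_coord, ae_map_iff hc.aemeasurable (measurableSet_eq_fun hf.1 hm)]
  filter_upwards [h7] with p hp
  rw [hp, S.proj_coord]

/-- The average of `g` over the lines parallel to `v`. -/
noncomputable def average (g : EuclideanSpace ℝ (Fin (d + 1)) → (Fin m → ℝ))
    (z : EuclideanSpace ℝ (Fin d)) (j : Fin m) : ℝ :=
  ∫ t, g (S.coord (t, z)) j ∂(gaussianReal 0 1)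

theorem simplexMap_average {g : EuclideanSpace ℝ (Fin (d + 1)) → (Fin m → ℝ)}
    (hg : SimplexMap (d + 1) m g) : SimplexMap d m (S.average g) := by
  have hc := S.measurable_coord
  have hm : ∀ j, Measurable fun p : ℝ × EuclideanSpace ℝ (Fin d) => g (S.coord p) j :=
    fun j => (hg.measurable_apply j).comp hc
  refine ⟨measurable_pi_lambda _ fun j => ?_, fun z => ⟨fun j => ?_, ?_⟩⟩
  · exact (hm j).stronglyMeasurable.integral_prod_left'.measurable
  · exact integral_nonneg fun t => hg.nonneg _ j
  · simp only [average]
    rw [← integral_finsetSum]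
    · simp [hg.sum_eq]
    · exact fun j _ => integrable_of_abs_le ((hm j).comp (by fun_prop)) fun t => hg.abs_le _ j

theorem integral_mul_comp_proj {g : EuclideanSpace ℝ (Fin (d + 1)) → (Fin m → ℝ)}
    (hg : SimplexMap (d + 1) m g) {h : EuclideanSpace ℝ (Fin d) → ℝ} (hh : Measurable h)
    {B : ℝ} (hB : ∀ z, |h z| ≤ B) (j : Fin m) :
    ∫ x, g x j * h (S.proj x) ∂(gauss (d + 1)) = ∫ z, S.average g z j * h z ∂(gauss d) := by
  have hc := S.measurable_coord
  have hm : Measurable fun x => g x j * h (S.proj x) :=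
    (hg.measurable_apply j).mul (hh.comp (by fun_prop))
  rw [← S.map_coord, integral_map hc.aemeasurable hm.aestronglyMeasurable, integral_prod_symm]
  · simp_rw [S.proj_coord, integral_mul_const]
    rfl
  · refine integrable_of_abs_le (B := 1 * B) (hm.comp hc) fun p => ?_
    rw [abs_mul]
    exact mul_le_mul (hg.abs_le _ j) (hB _) (abs_nonneg _) zero_le_one

end Splitting

theorem Cmat_mem_Sset_of_invariant (h1 : -1 ≤ ρ) (h2 : ρ ≤ 1)
    {f g : EuclideanSpace ℝ (Fin (d + 1)) → (Fin m → ℝ)}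
    (hf : SimplexMap (d + 1) m f) (hg : SimplexMap (d + 1) m g)
    {v : EuclideanSpace ℝ (Fin (d + 1))} (hv : ‖v‖ = 1)
    (hinv : ∀ T : ℝ, ∀ᵐ x ∂(gauss (d + 1)), f (x + T • v) = f x) :
    Cmat (d + 1) m ρ f g ∈ Sset ρ m d := by
  obtain ⟨S⟩ := exists_splitting hv
  obtain ⟨F, hF, hfF⟩ := S.exists_ae_eq_comp_proj hf hinv
  have hG := S.simplexMap_average hg
  refine ⟨F, S.average g, hF, hG, ?_⟩
  ext i j
  have hFp : SimplexMap (d + 1) m fun x => F (S.proj x) := hF.comp (by fun_prop)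
  have e1 : Cmat (d + 1) m ρ f g i j = Cmat (d + 1) m ρ (fun x => F (S.proj x)) g i j := by
    simp only [Cmat, Matrix.of_apply]
    refine integral_congr_ae ?_
    filter_upwards [hfF] with x hx
    rw [hx]
  rw [e1, Cmat_transpose h1 h2 hFp.bddMeasurable hg.bddMeasurable,
    Cmat_transpose h1 h2 hF.bddMeasurable hG.bddMeasurable]
  simp only [Cmat, Matrix.of_apply]
  simp_rw [S.OU_comp_proj (hF.measurable_apply i)]
  exact S.integral_mul_comp_proj hg (measurable_OU (hF.measurable_apply i))
    (abs_OU_le fun x => hF.abs_le x i) j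

theorem Sset_subset_succ : Sset ρ m d ⊆ Sset ρ m (d + 1) := by
  rintro _ ⟨f, g, hf, hg, rfl⟩
  obtain ⟨S⟩ := exists_splitting (d := d) (v := EuclideanSpace.single 0 1) (by simp)
  exact ⟨_, _, hf.comp (by fun_prop), hg.comp (by fun_prop), (S.Cmat_comp_proj hf hg).symm⟩

end Reduction

/-! ### Descent in the dimension -/

section Descent

variable {d m : ℕ} {ρ : ℝ}

theorem SimplexMap.integral_dotProduct_self_le {f : EuclideanSpace ℝ (Fin d) → (Fin m → ℝ)}
    (hf : SimplexMap d m f) : ∫ x, f x ⬝ᵥ f x ∂(gauss d) ≤ 1 := by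
  have h : ∀ x, |f x ⬝ᵥ f x| ≤ 1 := fun x => by
    rw [abs_of_nonneg (dotProduct_self_nonneg_real _), ← hf.sum_eq x]
    exact Finset.sum_le_sum fun i _ => mul_le_of_le_one_left (hf.nonneg x i) (hf.le_one x i)
  exact (le_abs_self _).trans (abs_integral_le_of_abs_le (ae_of_all _ h))

theorem Sset_succ_subset (h1 : -1 < ρ) (h2 : ρ < 1) (hm : 0 < m) (hd : m ^ 2 ≤ d + 1) :
    Sset ρ m (d + 1) ⊆ Sset ρ m d := by
  rintro _ ⟨f₀, g₀, hf₀, hg₀, rfl⟩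
  set P := Cmat (d + 1) m ρ f₀ g₀ with hP
  have key : ∀ n : ℕ, ∃ M ∈ Sset ρ m d, ∀ i j, (M i j - P i j) ^ 2 ≤ 2 * (1 / ((n : ℝ) + 1)) := by
    intro n
    have hδ : (0 : ℝ) < 1 / ((n : ℝ) + 1) := by positivity
    obtain ⟨f, g, hf, hg, hmin⟩ := exists_penalizedDist_minimizer h1 h2 hδ.le P hf₀ hg₀
    obtain ⟨v, hv, hinv⟩ := exists_invariant_direction_of_minimizer h1 h2 hδ hm hd hf hg hmin
    refine ⟨_, Cmat_mem_Sset_of_invariant h1.le h2.le hf hg hv hinv, fun i j => ?_⟩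
    have hle := hmin f₀ g₀ hf₀ hg₀
    have hsing : (Cmat (d + 1) m ρ f g i j - P i j) ^ 2 ≤
        ∑ i, ∑ j, (Cmat (d + 1) m ρ f g i j - P i j) ^ 2 :=
      (Finset.single_le_sum (f := fun j => (Cmat (d + 1) m ρ f g i j - P i j) ^ 2)
        (fun _ _ => sq_nonneg _) (Finset.mem_univ j)).trans
      (Finset.single_le_sum (f := fun i => ∑ j, (Cmat (d + 1) m ρ f g i j - P i j) ^ 2)
        (fun _ _ => Finset.sum_nonneg fun _ _ => sq_nonneg _) (Finset.mem_univ i))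
    have hpen : 0 ≤ 1 / ((n : ℝ) + 1) *
        (∫ x, f x ⬝ᵥ f x ∂(gauss (d + 1)) + ∫ x, g x ⬝ᵥ g x ∂(gauss (d + 1))) :=
      mul_nonneg hδ.le (add_nonneg (integral_nonneg fun x => dotProduct_self_nonneg_real _)
        (integral_nonneg fun x => dotProduct_self_nonneg_real _))
    have hpen₀ := mul_le_mul_of_nonneg_left
      (add_le_add hf₀.integral_dotProduct_self_le hg₀.integral_dotProduct_self_le) hδ.le
    simp only [penalizedDist, ← hP, sub_self, ne_eq, OfNat.ofNat_ne_zero, not_false_eq_true,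
      zero_pow, Finset.sum_const_zero, zero_add] at hle
    linarith
  choose M hM hMP using key
  refine isSeqClosed_Sset h1 h2 hM (tendsto_pi_nhds.2 fun i => tendsto_pi_nhds.2 fun j => ?_)
  have hlim : Tendsto (fun n : ℕ => 2 * (1 / ((n : ℝ) + 1))) atTop (𝓝 0) := by
    simpa using tendsto_one_div_add_atTop_nhds_zero_nat.const_mul (2 : ℝ)
  have hsq := squeeze_zero (fun n => sq_nonneg (M n i j - P i j)) (fun n => hMP n i j) hlim
  have habs : Tendsto (fun n => |M n i j - P i j|) atTop (𝓝 0) := by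
    simpa [Real.sqrt_sq_eq_abs] using hsq.sqrt
  exact tendsto_sub_nhds_zero_iff.1 ((tendsto_zero_iff_abs_tendsto_zero _).2 habs)

end Descent

theorem gaussian_simulatable_set_stabilizes (ρ : ℝ) (hρ₁ : -1 < ρ) (hρ₂ : ρ < 1)
    (m : ℕ) (hm : 2 ≤ m) (k : ℕ) (hk : m ^ 2 - 1 ≤ k) :
    Sset ρ m k = Sset ρ m (m ^ 2 - 1) := by
  induction k, hk using Nat.le_induction with
  | base => rfl
  | succ d hd ih =>
    rw [← ih]
    exact (Sset_succ_subset hρ₁ hρ₂ (by lia) (by lia)).antisymm Sset_subset_succ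
end

section
/- Let −1 < ρ < 1 and let (X,Y) be a pair of ρ-correlated standard Gaussian random variables, i.e., the joint law of (X,Y) on ℝ² is the pushforward of the standard Gaussian measure γ_2 on ℝ² under the map (x,y) ↦ (x, ρx + √(1−ρ²) y). Then the Hirschfeld–Gebelein–Rényi maximal correlation satisfies ρ_M(X,Y) = |ρ|. -/
open MeasureTheory

/-- Hirschfeld–Gebelein–Rényi maximal correlation of a joint law `μ` on `ℝ × ℝ`
(the value `0` is included to cover the degenerate case where no admissible `φ, ψ` exist). -/
noncomputable def maxCorr (μ : Measure (ℝ × ℝ)) : ℝ :=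
  sSup ({0} ∪ { r | ∃ φ ψ : ℝ → ℝ, Measurable φ ∧ Measurable ψ ∧
    (∫ p, φ p.1 ∂μ) = 0 ∧ (∫ p, (φ p.1) ^ 2 ∂μ) = 1 ∧
    (∫ p, ψ p.2 ∂μ) = 0 ∧ (∫ p, (ψ p.2) ^ 2 ∂μ) = 1 ∧
    r = ∫ p, φ p.1 * ψ p.2 ∂μ })

/-- The standard Gaussian measure on `ℝ²`, with density `(2π)⁻¹ exp(−‖x‖²/2)`. -/
noncomputable def gauss2 : Measure (ℝ × ℝ) :=
  (volume : Measure (ℝ × ℝ)).withDensity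
    (fun p => ENNReal.ofReal ((2 * Real.pi)⁻¹ * Real.exp (-(p.1 ^ 2 + p.2 ^ 2) / 2)))

open ProbabilityTheory

/-- The Mehler kernel: the density of the law of a pair of `σ`-correlated standard Gaussians
with respect to the product of its marginals. -/
noncomputable def mehlerKernel (σ x y : ℝ) : ℝ :=
  (√(1 - σ ^ 2))⁻¹ *
    Real.exp (-(σ ^ 2 * x ^ 2 + σ ^ 2 * y ^ 2 - 2 * σ * x * y) / (2 * (1 - σ ^ 2)))

lemma mehlerKernel_nonneg (σ x y : ℝ) : 0 ≤ mehlerKernel σ x y := by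
  unfold mehlerKernel
  positivity

lemma mehlerKernel_comm (σ x y : ℝ) : mehlerKernel σ x y = mehlerKernel σ y x := by
  unfold mehlerKernel
  congr 3
  ring

lemma measurable_mehlerKernel (σ : ℝ) :
    Measurable fun p : ℝ × ℝ => mehlerKernel σ p.1 p.2 := by
  unfold mehlerKernel
  fun_prop

lemma mehlerKernel_mul_gaussianPDFReal {σ : ℝ} (hσ : σ ^ 2 < 1) (x y : ℝ) :
    mehlerKernel σ x y * gaussianPDFReal 0 1 y =
      gaussianPDFReal (σ * x) (1 - σ ^ 2).toNNReal y := by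
  have h : 0 < 1 - σ ^ 2 := by linarith
  unfold mehlerKernel gaussianPDFReal
  rw [Real.coe_toNNReal _ h.le, Real.sqrt_mul (x := 2 * Real.pi) (by positivity) (1 - σ ^ 2),
    NNReal.coe_one, mul_one, mul_mul_mul_comm,
    ← Real.exp_add, mul_inv, mul_comm (√(1 - σ ^ 2))⁻¹]
  congr 2
  field_simp
  ring

lemma mehlerKernel_mul_mehlerKernel {σ : ℝ} (hσ : σ ^ 2 < 1) (x y z : ℝ) :
    gaussianPDFReal 0 1 z * (mehlerKernel σ x z * mehlerKernel σ y z) =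
      mehlerKernel (σ ^ 2) x y *
        gaussianPDFReal (σ * (x + y) / (1 + σ ^ 2)) ((1 - σ ^ 2) / (1 + σ ^ 2)).toNNReal z := by
  have h : 0 < 1 - σ ^ 2 := by linarith
  have h' : 0 < 1 + σ ^ 2 := by positivity
  have h4 : 1 - (σ ^ 2) ^ 2 = (1 - σ ^ 2) * (1 + σ ^ 2) := by ring
  unfold mehlerKernel gaussianPDFReal
  have hs : √(1 - σ ^ 2) * √(1 - σ ^ 2) =
      √((1 - σ ^ 2) * (1 + σ ^ 2)) * √((1 - σ ^ 2) / (1 + σ ^ 2)) := by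
    rw [← Real.sqrt_mul h.le, ← Real.sqrt_mul (by positivity)]
    congr 1
    field_simp
  rw [Real.coe_toNNReal _ (by positivity),
    Real.sqrt_mul (x := 2 * Real.pi) (by positivity) ((1 - σ ^ 2) / (1 + σ ^ 2)),
    NNReal.coe_one, mul_one, h4, mul_mul_mul_comm (√(1 - σ ^ 2))⁻¹, ← Real.exp_add,
    mul_mul_mul_comm, ← Real.exp_add, mul_mul_mul_comm, ← Real.exp_add, ← mul_inv, hs,
    ← mul_inv, ← mul_inv]
  congr 2
  · ring
  · field_simp
    ring

lemma mehlerKernel_diag_mul_gaussianPDFReal {τ : ℝ} (h₀ : 0 ≤ τ) (h₁ : τ < 1) (x : ℝ) :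
    gaussianPDFReal 0 1 x * mehlerKernel τ x x =
      (1 - τ)⁻¹ * gaussianPDFReal 0 ((1 + τ) / (1 - τ)).toNNReal x := by
  have h : 0 < 1 - τ := by linarith
  have h4 : 1 - τ ^ 2 = (1 - τ) * (1 + τ) := by ring
  have hs : √((1 - τ) * (1 + τ)) = (1 - τ) * √((1 + τ) / (1 - τ)) := by
    rw [← Real.sqrt_sq h.le, ← Real.sqrt_mul (by positivity), Real.sqrt_sq h.le]
    congr 1
    field_simp
  unfold mehlerKernel gaussianPDFReal
  rw [Real.coe_toNNReal _ (by positivity),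
    Real.sqrt_mul (x := 2 * Real.pi) (by positivity) ((1 + τ) / (1 - τ)),
    NNReal.coe_one, mul_one, h4, mul_mul_mul_comm, ← Real.exp_add, ← mul_assoc (1 - τ)⁻¹, hs,
    ← mul_inv, ← mul_inv]
  congr 2
  · ring
  · field_simp
    ring

lemma integral_stdGaussian (f : ℝ → ℝ) :
    ∫ x, f x ∂gaussianReal 0 1 = ∫ x, gaussianPDFReal 0 1 x * f x := by
  simp [integral_gaussianReal_eq_integral_smul (one_ne_zero)]

lemma integral_mehlerKernel_mul_mehlerKernel {σ : ℝ} (hσ : σ ^ 2 < 1) (x y : ℝ) :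
    ∫ z, mehlerKernel σ x z * mehlerKernel σ y z ∂gaussianReal 0 1 =
      mehlerKernel (σ ^ 2) x y := by
  have h : 0 < (1 - σ ^ 2) / (1 + σ ^ 2) := div_pos (by linarith) (by positivity)
  simp_rw [integral_stdGaussian, mehlerKernel_mul_mehlerKernel hσ, integral_const_mul]
  rw [integral_gaussianPDFReal_eq_one _ (Real.toNNReal_pos.2 h).ne', mul_one]

lemma integral_mehlerKernel_diag {τ : ℝ} (h₀ : 0 ≤ τ) (h₁ : τ < 1) :
    ∫ x, mehlerKernel τ x x ∂gaussianReal 0 1 = (1 - τ)⁻¹ := by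
  have h : 0 < (1 + τ) / (1 - τ) := div_pos (by linarith) (by linarith)
  simp_rw [integral_stdGaussian, mehlerKernel_diag_mul_gaussianPDFReal h₀ h₁, integral_const_mul]
  rw [integral_gaussianPDFReal_eq_one _ (Real.toNNReal_pos.2 h).ne', mul_one]

lemma integrable_stdGaussian_of_integrable {f : ℝ → ℝ}
    (h : Integrable fun x => gaussianPDFReal 0 1 x * f x) : Integrable f (gaussianReal 0 1) := by
  rw [gaussianReal_of_var_ne_zero _ one_ne_zero,
    integrable_withDensity_iff_integrable_smul' (measurable_gaussianPDF 0 1)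
      (by simp [gaussianPDF])]
  simpa [gaussianPDF, ENNReal.toReal_ofReal (gaussianPDFReal_nonneg _ _ _)] using h

lemma integrable_mehlerKernel_mul_mehlerKernel {σ : ℝ} (hσ : σ ^ 2 < 1) (x y : ℝ) :
    Integrable (fun z => mehlerKernel σ x z * mehlerKernel σ y z) (gaussianReal 0 1) := by
  apply integrable_stdGaussian_of_integrable
  simp_rw [mehlerKernel_mul_mehlerKernel hσ]
  exact (integrable_gaussianPDFReal _ _).const_mul _

lemma integrable_mehlerKernel_diag {τ : ℝ} (h₀ : 0 ≤ τ) (h₁ : τ < 1) :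
    Integrable (fun x => mehlerKernel τ x x) (gaussianReal 0 1) := by
  apply integrable_stdGaussian_of_integrable
  simp_rw [mehlerKernel_diag_mul_gaussianPDFReal h₀ h₁]
  exact (integrable_gaussianPDFReal _ _).const_mul _

lemma gaussianReal_eq_withDensity_mehlerKernel {σ : ℝ} (hσ : σ ^ 2 < 1) (x : ℝ) :
    gaussianReal (σ * x) (1 - σ ^ 2).toNNReal =
      (gaussianReal 0 1).withDensity fun y => ENNReal.ofReal (mehlerKernel σ x y) := by
  have h : 0 < 1 - σ ^ 2 := by linarith
  have hm : Measurable fun y => ENNReal.ofReal (mehlerKernel σ x y) :=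
    ((measurable_mehlerKernel σ).comp measurable_prodMk_left).ennreal_ofReal
  rw [gaussianReal_of_var_ne_zero _ (Real.toNNReal_pos.2 h).ne',
    gaussianReal_of_var_ne_zero _ one_ne_zero, ← withDensity_mul _ (measurable_gaussianPDF 0 1) hm]
  congr 1
  ext y
  simp only [Pi.mul_apply, gaussianPDF]
  rw [← ENNReal.ofReal_mul (gaussianPDFReal_nonneg _ _ _), mul_comm (gaussianPDFReal 0 1 y),
    mehlerKernel_mul_gaussianPDFReal hσ]

lemma map_stdGaussian_affine {σ : ℝ} (hσ : σ ^ 2 < 1) (x : ℝ) :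
    (gaussianReal 0 1).map (fun y => σ * x + √(1 - σ ^ 2) * y) =
      gaussianReal (σ * x) (1 - σ ^ 2).toNNReal := by
  have h : 0 ≤ 1 - σ ^ 2 := by linarith
  have : (fun y => σ * x + √(1 - σ ^ 2) * y) =
      (fun y => σ * x + y) ∘ fun y => √(1 - σ ^ 2) * y := rfl
  rw [this, ← Measure.map_map (by fun_prop) (by fun_prop), gaussianReal_map_const_mul,
    gaussianReal_map_const_add]
  congr 1
  · ring
  · ext
    simp [Real.sq_sqrt h, Real.coe_toNNReal _ h]

/-- The law of a pair of `σ`-correlated standard Gaussians, described by its density. -/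
noncomputable def correlatedGaussian (σ : ℝ) : Measure (ℝ × ℝ) :=
  ((gaussianReal 0 1).prod (gaussianReal 0 1)).withDensity
    fun p => ENNReal.ofReal (mehlerKernel σ p.1 p.2)

lemma map_prod_stdGaussian {σ : ℝ} (hσ : σ ^ 2 < 1) :
    ((gaussianReal 0 1).prod (gaussianReal 0 1)).map
      (fun p : ℝ × ℝ => (p.1, σ * p.1 + √(1 - σ ^ 2) * p.2)) = correlatedGaussian σ := by
  have hT : Measurable fun p : ℝ × ℝ => (p.1, σ * p.1 + √(1 - σ ^ 2) * p.2) := by fun_prop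
  ext s hs
  have hK := (measurable_mehlerKernel σ).ennreal_ofReal
  rw [Measure.map_apply hT hs, Measure.prod_apply (hT hs), correlatedGaussian,
    withDensity_apply _ hs, ← lintegral_indicator hs,
    lintegral_prod _ (hK.indicator hs).aemeasurable]
  refine lintegral_congr fun x => ?_
  have hx : MeasurableSet (Prod.mk x ⁻¹' s) := measurable_prodMk_left hs
  trans (gaussianReal 0 1).map (fun y => σ * x + √(1 - σ ^ 2) * y) (Prod.mk x ⁻¹' s)
  · rw [Measure.map_apply (by fun_prop) hx]
    rfl
  · rw [map_stdGaussian_affine hσ, gaussianReal_eq_withDensity_mehlerKernel hσ,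
      withDensity_apply _ hx, ← lintegral_indicator hx]
    rfl

lemma gauss2_eq_prod : gauss2 = (gaussianReal 0 1).prod (gaussianReal 0 1) := by
  rw [gaussianReal_of_var_ne_zero _ one_ne_zero,
    prod_withDensity (measurable_gaussianPDF 0 1) (measurable_gaussianPDF 0 1), gauss2]
  congr 1
  ext p
  simp only [gaussianPDF]
  rw [← ENNReal.ofReal_mul (gaussianPDFReal_nonneg _ _ _)]
  congr 1
  simp only [gaussianPDFReal, NNReal.coe_one, mul_one, sub_zero]
  rw [mul_mul_mul_comm, ← Real.exp_add, ← mul_inv, Real.mul_self_sqrt (by positivity)]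
  congr 2
  ring

lemma map_fst_correlatedGaussian {σ : ℝ} (hσ : σ ^ 2 < 1) :
    (correlatedGaussian σ).map Prod.fst = gaussianReal 0 1 := by
  rw [← map_prod_stdGaussian hσ, Measure.map_map measurable_fst (by fun_prop)]
  exact Measure.map_fst_prod.trans (by simp)

lemma map_swap_correlatedGaussian (σ : ℝ) :
    (correlatedGaussian σ).map Prod.swap = correlatedGaussian σ := by
  have hK := (measurable_mehlerKernel σ).ennreal_ofReal
  ext s hs
  rw [Measure.map_apply measurable_swap hs, correlatedGaussian, withDensity_apply _ hs,
    withDensity_apply _ (measurable_swap hs), ← lintegral_indicator hs,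
    ← lintegral_indicator (measurable_swap hs), ← lintegral_prod_swap]
  refine lintegral_congr fun p => ?_
  simp only [Set.indicator, Set.mem_preimage, Prod.swap_swap, Prod.fst_swap, Prod.snd_swap,
    mehlerKernel_comm σ p.2 p.1]
  rfl

lemma map_snd_correlatedGaussian {σ : ℝ} (hσ : σ ^ 2 < 1) :
    (correlatedGaussian σ).map Prod.snd = gaussianReal 0 1 := by
  rw [← map_swap_correlatedGaussian, Measure.map_map measurable_snd measurable_swap]
  exact map_fst_correlatedGaussian hσ

lemma measurePreserving_fst_correlatedGaussian {σ : ℝ} (hσ : σ ^ 2 < 1) :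
    MeasurePreserving Prod.fst (correlatedGaussian σ) (gaussianReal 0 1) :=
  ⟨measurable_fst, map_fst_correlatedGaussian hσ⟩

lemma measurePreserving_snd_correlatedGaussian {σ : ℝ} (hσ : σ ^ 2 < 1) :
    MeasurePreserving Prod.snd (correlatedGaussian σ) (gaussianReal 0 1) :=
  ⟨measurable_snd, map_snd_correlatedGaussian hσ⟩

lemma integral_fst_correlatedGaussian {σ : ℝ} (hσ : σ ^ 2 < 1) {f : ℝ → ℝ} (hf : Measurable f) :
    ∫ p, f p.1 ∂correlatedGaussian σ = ∫ x, f x ∂gaussianReal 0 1 := by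
  rw [← map_fst_correlatedGaussian hσ,
    integral_map measurable_fst.aemeasurable hf.aestronglyMeasurable]

lemma integral_snd_correlatedGaussian {σ : ℝ} (hσ : σ ^ 2 < 1) {f : ℝ → ℝ} (hf : Measurable f) :
    ∫ p, f p.2 ∂correlatedGaussian σ = ∫ x, f x ∂gaussianReal 0 1 := by
  rw [← map_snd_correlatedGaussian hσ,
    integral_map measurable_snd.aemeasurable hf.aestronglyMeasurable]

lemma integral_correlatedGaussian (σ : ℝ) (F : ℝ × ℝ → ℝ) :
    ∫ p, F p ∂correlatedGaussian σ =
      ∫ p, mehlerKernel σ p.1 p.2 * F p ∂(gaussianReal 0 1).prod (gaussianReal 0 1) := by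
  rw [correlatedGaussian, integral_withDensity_eq_integral_toReal_smul
    (measurable_mehlerKernel σ).ennreal_ofReal (by simp)]
  simp [ENNReal.toReal_ofReal (mehlerKernel_nonneg _ _ _)]

lemma integrable_correlatedGaussian_iff (σ : ℝ) (F : ℝ × ℝ → ℝ) :
    Integrable F (correlatedGaussian σ) ↔ Integrable
      (fun p => mehlerKernel σ p.1 p.2 * F p) ((gaussianReal 0 1).prod (gaussianReal 0 1)) := by
  rw [correlatedGaussian, integrable_withDensity_iff_integrable_smul'
    (measurable_mehlerKernel σ).ennreal_ofReal (by simp)]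
  simp [ENNReal.toReal_ofReal (mehlerKernel_nonneg _ _ _)]

lemma integrable_mul_correlatedGaussian {σ : ℝ} (hσ : σ ^ 2 < 1) {f g : ℝ → ℝ}
    (hf : MemLp f 2 (gaussianReal 0 1)) (hg : MemLp g 2 (gaussianReal 0 1)) :
    Integrable (fun p : ℝ × ℝ => f p.1 * g p.2) (correlatedGaussian σ) :=
  (hf.comp_measurePreserving (measurePreserving_fst_correlatedGaussian hσ)).integrable_mul
    (hg.comp_measurePreserving (measurePreserving_snd_correlatedGaussian hσ))

/-- The Cauchy–Schwarz inequality for real integrals. -/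
lemma sq_integral_mul_le {α : Type*} [MeasurableSpace α] {μ : Measure α} {a b : α → ℝ}
    (ha : MemLp a 2 μ) (hb : MemLp b 2 μ) :
    (∫ x, a x * b x ∂μ) ^ 2 ≤ (∫ x, a x ^ 2 ∂μ) * ∫ x, b x ^ 2 ∂μ := by
  have hab : Integrable (fun x => a x * b x) μ := ha.integrable_mul hb
  have h : ∀ t : ℝ, 0 ≤ (∫ x, b x ^ 2 ∂μ) * (t * t) + 2 * (∫ x, a x * b x ∂μ) * t +
      ∫ x, a x ^ 2 ∂μ := by
    intro t
    have : 0 ≤ ∫ x, (b x ^ 2 * (t * t) + a x * b x * (2 * t) + a x ^ 2) ∂μ :=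
      integral_nonneg fun x => by
        have : b x ^ 2 * (t * t) + a x * b x * (2 * t) + a x ^ 2 = (b x * t + a x) ^ 2 := by ring
        simp only [Pi.zero_apply, this]
        positivity
    have h1 := hb.integrable_sq.mul_const (t * t)
    have h2 := hab.mul_const (2 * t)
    rw [integral_add (by exact h1.add h2) ha.integrable_sq, integral_add h1 h2,
      integral_mul_const, integral_mul_const] at this
    linarith
  have := discrim_le_zero h
  rw [discrim] at this
  linarith

lemma measurable_mehlerKernel_mul (σ : ℝ) {f : ℝ → ℝ} (hf : Measurable f) :
    Measurable fun q : ℝ × ℝ => mehlerKernel σ q.2 q.1 * f q.2 :=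
  ((measurable_mehlerKernel σ).comp measurable_swap).mul (hf.comp measurable_snd)

lemma integrable_mehlerKernel_mul_mul {σ : ℝ} (hσ : σ ^ 2 < 1) {f : ℝ → ℝ}
    (hfm : Measurable f) (hf : MemLp f 2 (gaussianReal 0 1)) :
    Integrable (fun q : ℝ × (ℝ × ℝ) =>
      (mehlerKernel σ q.2.1 q.1 * f q.2.1) * (mehlerKernel σ q.2.2 q.1 * f q.2.2))
      ((gaussianReal 0 1).prod ((gaussianReal 0 1).prod (gaussianReal 0 1))) := by
  have hσ2 : (σ ^ 2) ^ 2 < 1 := pow_lt_one₀ (sq_nonneg σ) hσ two_ne_zero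
  have hKf := measurable_mehlerKernel_mul σ hfm
  have hFm : Measurable fun q : ℝ × (ℝ × ℝ) =>
      (mehlerKernel σ q.2.1 q.1 * f q.2.1) * (mehlerKernel σ q.2.2 q.1 * f q.2.2) :=
    .mul (hKf.comp (g := fun q : ℝ × ℝ => mehlerKernel σ q.2 q.1 * f q.2)
        (f := fun q : ℝ × (ℝ × ℝ) => (q.1, q.2.1)) (by fun_prop))
      (hKf.comp (g := fun q : ℝ × ℝ => mehlerKernel σ q.2 q.1 * f q.2)
        (f := fun q : ℝ × (ℝ × ℝ) => (q.1, q.2.2)) (by fun_prop))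
  rw [integrable_prod_iff' hFm.aestronglyMeasurable]
  constructor
  · refine .of_forall fun p => ?_
    simpa only [mul_mul_mul_comm] using
      (integrable_mehlerKernel_mul_mehlerKernel hσ p.1 p.2).mul_const (f p.1 * f p.2)
  · refine ((integrable_correlatedGaussian_iff _ _).1
      (integrable_mul_correlatedGaussian hσ2 hf hf)).norm.congr (.of_forall fun p => ?_)
    simp only
    rw [norm_mul, Real.norm_of_nonneg (mehlerKernel_nonneg _ _ _),
      ← integral_mehlerKernel_mul_mehlerKernel hσ, ← integral_mul_const]
    refine integral_congr_ae (.of_forall fun y => ?_)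
    simp only [norm_mul, Real.norm_of_nonneg (mehlerKernel_nonneg _ _ _)]
    ring

/-- The conditional expectation of `f X` given `Y = y`. -/
noncomputable def mehlerOperator (σ : ℝ) (f : ℝ → ℝ) (y : ℝ) : ℝ :=
  ∫ x, mehlerKernel σ x y * f x ∂gaussianReal 0 1

lemma mehlerOperator_sq (σ : ℝ) (f : ℝ → ℝ) (y : ℝ) :
    mehlerOperator σ f y ^ 2 =
      ∫ p : ℝ × ℝ, (mehlerKernel σ p.1 y * f p.1) * (mehlerKernel σ p.2 y * f p.2)
        ∂(gaussianReal 0 1).prod (gaussianReal 0 1) := by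
  rw [integral_prod_mul (fun x => mehlerKernel σ x y * f x)
    (fun x => mehlerKernel σ x y * f x), sq, mehlerOperator]

lemma memLp_two_mehlerOperator {σ : ℝ} (hσ : σ ^ 2 < 1) {f : ℝ → ℝ}
    (hfm : Measurable f) (hf : MemLp f 2 (gaussianReal 0 1)) :
    MemLp (mehlerOperator σ f) 2 (gaussianReal 0 1) := by
  have hm : AEStronglyMeasurable (mehlerOperator σ f) (gaussianReal 0 1) :=
    ((measurable_mehlerKernel_mul σ hfm).stronglyMeasurable.integral_prod_right'
      (ν := gaussianReal 0 1)).aestronglyMeasurable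
  rw [memLp_two_iff_integrable_sq hm]
  simp_rw [mehlerOperator_sq]
  exact (integrable_mehlerKernel_mul_mul hσ hfm hf).integral_prod_left

lemma integral_mehlerOperator_sq {σ : ℝ} (hσ : σ ^ 2 < 1) {f : ℝ → ℝ}
    (hfm : Measurable f) (hf : MemLp f 2 (gaussianReal 0 1)) :
    ∫ y, mehlerOperator σ f y ^ 2 ∂gaussianReal 0 1 =
      ∫ p, f p.1 * f p.2 ∂correlatedGaussian (σ ^ 2) := by
  simp_rw [mehlerOperator_sq]
  rw [integral_integral_swap (integrable_mehlerKernel_mul_mul hσ hfm hf),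
    integral_correlatedGaussian]
  refine integral_congr_ae (.of_forall fun p => ?_)
  simp only
  rw [← integral_mehlerKernel_mul_mehlerKernel hσ, ← integral_mul_const]
  refine integral_congr_ae (.of_forall fun y => ?_)
  simp only
  ring

lemma integral_correlatedGaussian_eq_integral_mehlerOperator {σ : ℝ} (hσ : σ ^ 2 < 1)
    {f g : ℝ → ℝ} (hf : MemLp f 2 (gaussianReal 0 1)) (hg : MemLp g 2 (gaussianReal 0 1)) :
    ∫ p, f p.1 * g p.2 ∂correlatedGaussian σ =
      ∫ y, mehlerOperator σ f y * g y ∂gaussianReal 0 1 := by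
  rw [integral_correlatedGaussian, integral_prod_symm _
    ((integrable_correlatedGaussian_iff _ _).1 (integrable_mul_correlatedGaussian hσ hf hg))]
  simp only [mehlerOperator, ← integral_mul_const, mul_assoc]

lemma sq_integral_correlatedGaussian_le {σ : ℝ} (hσ : σ ^ 2 < 1) {f g : ℝ → ℝ}
    (hfm : Measurable f) (hf : MemLp f 2 (gaussianReal 0 1)) (hg : MemLp g 2 (gaussianReal 0 1)) :
    (∫ p, f p.1 * g p.2 ∂correlatedGaussian σ) ^ 2 ≤
      (∫ p, f p.1 * f p.2 ∂correlatedGaussian (σ ^ 2)) * ∫ x, g x ^ 2 ∂gaussianReal 0 1 := by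
  rw [integral_correlatedGaussian_eq_integral_mehlerOperator hσ hf hg,
    ← integral_mehlerOperator_sq hσ hfm hf]
  exact sq_integral_mul_le (memLp_two_mehlerOperator hσ hfm hf) hg

lemma memLp_two_mehlerKernel {σ : ℝ} (hσ : σ ^ 2 < 1) :
    MemLp (fun p : ℝ × ℝ => mehlerKernel σ p.1 p.2) 2
      ((gaussianReal 0 1).prod (gaussianReal 0 1)) := by
  have hm := measurable_mehlerKernel σ
  rw [memLp_two_iff_integrable_sq hm.aestronglyMeasurable,
    integrable_prod_iff (hm.pow_const 2).aestronglyMeasurable]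
  simp only [sq (mehlerKernel _ _ _), norm_mul, Real.norm_of_nonneg (mehlerKernel_nonneg _ _ _),
    integral_mehlerKernel_mul_mehlerKernel hσ, integrable_mehlerKernel_mul_mehlerKernel hσ,
    Filter.eventually_true, true_and]
  exact integrable_mehlerKernel_diag (sq_nonneg σ) hσ

/-- The Hilbert–Schmidt norm of the Mehler kernel. -/
lemma integral_mehlerKernel_sq {σ : ℝ} (hσ : σ ^ 2 < 1) :
    ∫ p, mehlerKernel σ p.1 p.2 ^ 2 ∂(gaussianReal 0 1).prod (gaussianReal 0 1) =
      (1 - σ ^ 2)⁻¹ := by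
  rw [integral_prod _ (memLp_two_mehlerKernel hσ).integrable_sq]
  simp_rw [sq (mehlerKernel _ _ _), integral_mehlerKernel_mul_mehlerKernel hσ]
  exact integral_mehlerKernel_diag (sq_nonneg σ) hσ

lemma integral_mehlerKernel {σ : ℝ} (hσ : σ ^ 2 < 1) :
    ∫ p, mehlerKernel σ p.1 p.2 ∂(gaussianReal 0 1).prod (gaussianReal 0 1) = 1 := by
  have := integral_correlatedGaussian σ fun _ => 1
  rw [integral_fst_correlatedGaussian hσ (f := fun _ => 1) measurable_const] at this
  simpa using this.symm

lemma sq_integral_correlatedGaussian_le_of_integral_eq_zero {σ : ℝ} (hσ : σ ^ 2 < 1) {f : ℝ → ℝ}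
    (hf : MemLp f 2 (gaussianReal 0 1)) (h0 : ∫ x, f x ∂gaussianReal 0 1 = 0)
    (h1 : ∫ x, f x ^ 2 ∂gaussianReal 0 1 = 1) :
    (∫ p, f p.1 * f p.2 ∂correlatedGaussian σ) ^ 2 ≤ σ ^ 2 / (1 - σ ^ 2) := by
  have hK := memLp_two_mehlerKernel hσ
  have hfi : Integrable f (gaussianReal 0 1) := hf.integrable one_le_two
  have hff : Integrable (fun p : ℝ × ℝ => f p.1 * f p.2)
      ((gaussianReal 0 1).prod (gaussianReal 0 1)) :=
    hfi.mul_prod hfi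
  have hff2 : MemLp (fun p : ℝ × ℝ => f p.1 * f p.2) 2
      ((gaussianReal 0 1).prod (gaussianReal 0 1)) := by
    rw [memLp_two_iff_integrable_sq hff.aestronglyMeasurable]
    simpa only [mul_pow] using hf.integrable_sq.mul_prod hf.integrable_sq
  have e1 : ∫ p, f p.1 * f p.2 ∂correlatedGaussian σ =
      ∫ p, (mehlerKernel σ p.1 p.2 - 1) * (f p.1 * f p.2)
        ∂(gaussianReal 0 1).prod (gaussianReal 0 1) := by
    simp_rw [sub_mul, one_mul]
    rw [integral_sub ((integrable_correlatedGaussian_iff _ _).1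
      (integrable_mul_correlatedGaussian hσ hf hf)) hff, integral_prod_mul, h0,
      integral_correlatedGaussian]
    simp
  have e2 : ∫ p, (mehlerKernel σ p.1 p.2 - 1) ^ 2 ∂(gaussianReal 0 1).prod (gaussianReal 0 1) =
      σ ^ 2 / (1 - σ ^ 2) := by
    have : ∀ p : ℝ × ℝ, (mehlerKernel σ p.1 p.2 - 1) ^ 2 =
        mehlerKernel σ p.1 p.2 ^ 2 - mehlerKernel σ p.1 p.2 * 2 + 1 := fun p => by ring
    have hKi : Integrable (fun p : ℝ × ℝ => mehlerKernel σ p.1 p.2 * 2)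
        ((gaussianReal 0 1).prod (gaussianReal 0 1)) :=
      (hK.integrable one_le_two).mul_const 2
    simp_rw [this]
    rw [integral_add (by exact hK.integrable_sq.sub hKi) (integrable_const 1),
      integral_sub hK.integrable_sq hKi, integral_mul_const, integral_mehlerKernel_sq hσ,
      integral_mehlerKernel hσ]
    have : 1 - σ ^ 2 ≠ 0 := by linarith
    simp
    field_simp
    ring
  have e3 : ∫ p, (f p.1 * f p.2) ^ 2 ∂(gaussianReal 0 1).prod (gaussianReal 0 1) = 1 := by
    simp_rw [mul_pow]
    rw [integral_prod_mul (fun x => f x ^ 2) (fun x => f x ^ 2), h1, mul_one]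
  have := sq_integral_mul_le (hK.sub (memLp_const 1)) hff2
  simp only [Pi.sub_apply] at this
  rwa [← e1, e2, e3, mul_one] at this

lemma le_of_pow_two_pow_le_mul {a b C : ℝ} (hb : 0 ≤ b)
    (h : ∀ n : ℕ, a ^ 2 ^ n ≤ C * b ^ 2 ^ n) : a ≤ b := by
  by_contra! hab
  have ha : 0 < a := hb.trans_lt hab
  rcases hb.eq_or_lt with rfl | hb
  · have := h 0
    simp at this
    linarith
  · obtain ⟨n, hn⟩ := pow_unbounded_of_one_lt C ((one_lt_div hb).2 hab)
    have h2 : (a / b) ^ n ≤ (a / b) ^ 2 ^ n :=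
      pow_le_pow_right₀ ((one_lt_div hb).2 hab).le Nat.lt_two_pow_self.le
    have h3 : (a / b) ^ 2 ^ n ≤ C := by
      rw [div_pow, div_le_iff₀ (by positivity)]
      exact h n
    linarith

/-- The upper bound on the correlation of functions of correlated Gaussians. -/
lemma integral_correlatedGaussian_le {ρ : ℝ} (hρ : ρ ^ 2 < 1) {f g : ℝ → ℝ} (hfm : Measurable f)
    (hf : MemLp f 2 (gaussianReal 0 1)) (hg : MemLp g 2 (gaussianReal 0 1))
    (hf0 : ∫ x, f x ∂gaussianReal 0 1 = 0) (hf1 : ∫ x, f x ^ 2 ∂gaussianReal 0 1 = 1)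
    (hg1 : ∫ x, g x ^ 2 ∂gaussianReal 0 1 = 1) :
    ∫ p, f p.1 * g p.2 ∂correlatedGaussian ρ ≤ |ρ| := by
  set r := ∫ p, f p.1 * g p.2 ∂correlatedGaussian ρ
  let b : ℕ → ℝ := fun n => ∫ p, f p.1 * f p.2 ∂correlatedGaussian ((ρ ^ 2) ^ 2 ^ n)
  have hlt : ∀ n : ℕ, (ρ ^ 2) ^ 2 ^ n ≤ ρ ^ 2 := fun n =>
    pow_le_of_le_one (sq_nonneg ρ) hρ.le (by positivity)
  have hlt' : ∀ n : ℕ, ((ρ ^ 2) ^ 2 ^ n) ^ 2 ≤ ρ ^ 2 := fun n => by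
    rw [← pow_mul, ← pow_succ]
    exact hlt (n + 1)
  have hstep : ∀ n, b n ^ 2 ≤ b (n + 1) := fun n => by
    have := sq_integral_correlatedGaussian_le ((hlt' n).trans_lt hρ) hfm hf hf
    rwa [hf1, mul_one, ← pow_mul (ρ ^ 2), ← pow_succ] at this
  have hr : r ^ 2 ≤ b 0 := by
    have := sq_integral_correlatedGaussian_le hρ hfm hf hg
    rw [hg1, mul_one] at this
    simpa [b] using this
  have hpow : ∀ n : ℕ, (r ^ 2) ^ 2 ^ n ≤ b n := fun n => by
    induction n with
    | zero => simpa using hr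
    | succ n ih =>
      rw [pow_succ 2 n, pow_mul]
      exact (pow_le_pow_left₀ (by positivity) ih 2).trans (hstep n)
  have hbound : ∀ n, b n ^ 2 ≤ (1 - ρ ^ 2)⁻¹ * ((ρ ^ 2) ^ 2) ^ 2 ^ n := fun n => by
    refine (sq_integral_correlatedGaussian_le_of_integral_eq_zero
      ((hlt' n).trans_lt hρ) hf hf0 hf1).trans ?_
    rw [pow_right_comm (ρ ^ 2) 2, div_eq_inv_mul]
    have := hlt' n
    have h1 : 0 < 1 - ρ ^ 2 := by linarith
    gcongr
  have hle : (r ^ 2) ^ 2 ≤ (ρ ^ 2) ^ 2 :=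
    le_of_pow_two_pow_le_mul (by positivity) fun n => by
      rw [pow_right_comm (r ^ 2) 2]
      exact (pow_le_pow_left₀ (by positivity) (hpow n) 2).trans (hbound n)
  exact (le_abs_self r).trans (sq_le_sq.1 ((sq_le_sq₀ (sq_nonneg r) (sq_nonneg ρ)).1 hle))

lemma integral_sq_stdGaussian : ∫ x, x ^ 2 ∂gaussianReal 0 1 = 1 := by
  have := variance_fun_id_gaussianReal (μ := 0) (v := 1)
  rw [variance_eq_integral (by fun_prop)] at this
  simpa using this

lemma integral_mul_correlatedGaussian {ρ : ℝ} (hρ : ρ ^ 2 < 1) :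
    ∫ p, p.1 * p.2 ∂correlatedGaussian ρ = ρ := by
  have hid : MemLp (fun x : ℝ => x) 2 (gaussianReal 0 1) := memLp_id_gaussianReal 2
  have hi := hid.integrable one_le_two
  rw [← map_prod_stdGaussian hρ, integral_map (by fun_prop) (by fun_prop)]
  have : ∀ p : ℝ × ℝ, p.1 * (ρ * p.1 + √(1 - ρ ^ 2) * p.2) =
      ρ * (p.1 ^ 2 * 1) + √(1 - ρ ^ 2) * (p.1 * p.2) := fun p => by ring
  simp_rw [this]
  rw [integral_add ((hid.integrable_sq.mul_prod (integrable_const 1)).const_mul ρ)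
    ((hi.mul_prod hi).const_mul _), integral_const_mul, integral_const_mul,
    integral_prod_mul (fun x : ℝ => x ^ 2) (fun _ => 1),
    integral_prod_mul (fun x : ℝ => x) (fun x => x), integral_sq_stdGaussian]
  simp [integral_id_gaussianReal]

theorem maximal_correlation_of_correlated_gaussians (ρ : ℝ) (hρ₁ : -1 < ρ) (hρ₂ : ρ < 1) :
    maxCorr (Measure.map
      (fun p : ℝ × ℝ => (p.1, ρ * p.1 + Real.sqrt (1 - ρ ^ 2) * p.2)) gauss2) = |ρ| := by
  have hρ : ρ ^ 2 < 1 := by nlinarith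
  rw [gauss2_eq_prod, map_prod_stdGaussian hρ]
  refine IsGreatest.csSup_eq ⟨Or.inr ?_, ?_⟩
  · obtain ⟨c, hc, hcρ⟩ : ∃ c : ℝ, c ^ 2 = 1 ∧ c * ρ = |ρ| := by
      rcases abs_choice ρ with h | h
      · exact ⟨1, by norm_num, by rw [h, one_mul]⟩
      · exact ⟨-1, by norm_num, by rw [h, neg_one_mul]⟩
    refine ⟨fun x => c * x, fun x => x, by fun_prop, by fun_prop, ?_, ?_, ?_, ?_, ?_⟩
    · rw [integral_fst_correlatedGaussian hρ (f := fun x => c * x) (by fun_prop),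
        integral_const_mul, integral_id_gaussianReal, mul_zero]
    · rw [integral_fst_correlatedGaussian hρ (f := fun x => (c * x) ^ 2) (by fun_prop)]
      simp_rw [mul_pow, hc, one_mul]
      exact integral_sq_stdGaussian
    · rw [integral_snd_correlatedGaussian hρ (f := fun x => x) (by fun_prop),
        integral_id_gaussianReal]
    · rw [integral_snd_correlatedGaussian hρ (f := fun x => x ^ 2) (by fun_prop)]
      exact integral_sq_stdGaussian
    · simp_rw [mul_assoc]
      rw [integral_const_mul, integral_mul_correlatedGaussian hρ, hcρ]
  · rintro r (rfl | ⟨φ, ψ, hφ, hψ, hφ0, hφ1, -, hψ1, rfl⟩)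
    · exact abs_nonneg ρ
    · rw [integral_fst_correlatedGaussian hρ hφ] at hφ0
      rw [integral_fst_correlatedGaussian hρ (hφ.pow_const 2)] at hφ1
      rw [integral_snd_correlatedGaussian hρ (hψ.pow_const 2)] at hψ1
      have hL2 : ∀ {f : ℝ → ℝ}, Measurable f → ∫ x, f x ^ 2 ∂gaussianReal 0 1 = 1 →
          MemLp f 2 (gaussianReal 0 1) := fun hf h =>
        (memLp_two_iff_integrable_sq hf.aestronglyMeasurable).2
          (not_imp_comm.1 integral_undef (by rw [h]; exact one_ne_zero))
      exact integral_correlatedGaussian_le hρ hφ (hL2 hφ hφ1) (hL2 hψ hψ1) hφ0 hφ1 hψ1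
end
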